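/- arXiv:1707.06536 — 3 statements merged into one kernel-verified Lean document; each statement's English description precedes it below -/
import Mathlib

section
/- Let R be a Noetherian integral domain and 𝔞 an ideal of R with cd(𝔞, R) = 1. Then Ann_R(H^1_𝔞(R)) = 0. -/
open CategoryTheory

/-- `HasCD a M c` : the cohomological dimension of `M` with respect to `a` is `c`,
i.e. `H^c_a(M) ≠ 0` and `H^i_a(M) = 0` for all `i > c`. -/
def HasCD {R : Type} [CommRing R] (a : Ideal R) (M : ModuleCat R) (c : ℕ) : Prop :=
  Nontrivial ((localCohomology a c).obj M) ∧
    ∀ i, c < i → Subsingleton ((localCohomology a i).obj M)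

namespace LC
open Limits Opposite
noncomputable section
variable {R : Type} [CommRing R]

/-- The chain map between Hom complexes induced by a chain map. -/
def homMap {P Q : ChainComplex (ModuleCat.{0} R) ℕ} (φ : P ⟶ Q) (Y : ModuleCat.{0} R) :
    Q.linearYonedaObj R Y ⟶ P.linearYonedaObj R Y :=
  (HomologicalComplex.unopFunctor _ _).map
    ((((linearYoneda R (ModuleCat.{0} R)).obj Y).rightOp.mapHomologicalComplex _).map φ).op

lemma homMap_f {P Q : ChainComplex (ModuleCat.{0} R) ℕ} (φ : P ⟶ Q) (Y : ModuleCat.{0} R) (n : ℕ)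
    (f : Q.X n ⟶ Y) : (homMap φ Y).f n f = φ.f n ≫ f := rfl

lemma aux_iso {D : Type*} [Category* D] {A A' B B' H H' : D} (m : A ⟶ A') (p' : A' ⟶ B')
    (p : A ⟶ B) (q : B ⟶ B') (v : H ≅ B) (v' : H' ≅ B') (k : H ⟶ H')
    (h1 : m ≫ p' = p ≫ q) (h2 : k ≫ v'.hom = v.hom ≫ q) :
    m ≫ p' ≫ v'.inv = (p ≫ v.inv) ≫ k := by
  rw [← cancel_mono v'.hom]
  simp [h1, h2]

lemma isoExt_natural {X' X : ModuleCat.{0} R} (g : X' ⟶ X) (P' : ProjectiveResolution X')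
    (P : ProjectiveResolution X) (φ : P'.complex ⟶ P.complex)
    (comm : φ.f 0 ≫ P.π.f 0 = P'.π.f 0 ≫ g) (n : ℕ) (Y : ModuleCat.{0} R) :
    ((Ext R (ModuleCat.{0} R) n).map g.op).app Y ≫ (P'.isoExt n Y).hom =
      (P.isoExt n Y).hom ≫ HomologicalComplex.homologyMap (homMap φ Y) n := by
  have h := P'.isoLeftDerivedObj_inv_naturality g P φ comm
    ((linearYoneda R (ModuleCat.{0} R)).obj Y).rightOp n
  have h2 := congrArg Quiver.Hom.unop h
  have h3 := HomologicalComplex.homologyOp_hom_naturality (homMap φ Y) n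
  have h4 := congrArg Quiver.Hom.unop h3
  exact aux_iso _ _ _ _ ((P.complex.linearYonedaObj R Y).homologyOp n).unop
    ((P'.complex.linearYonedaObj R Y).homologyOp n).unop _ h2 h4.symm

/-- comparison relation -/
def Rel (X Y : ModuleCat.{0} R) (n : ℕ) (x : ((Ext R (ModuleCat.{0} R) n).obj (op X)).obj Y)
    (α : Abelian.Ext X Y n) : Prop :=
  ∃ (z : ((projectiveResolution X).complex.linearYonedaObj R Y).cycles n)
    (f : (projectiveResolution X).complex.X n ⟶ Y)
    (hf : (projectiveResolution X).complex.d (n+1) n ≫ f = 0),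
    ((projectiveResolution X).isoExt n Y).hom x = 
      ((projectiveResolution X).complex.linearYonedaObj R Y).homologyπ n z ∧
    ((projectiveResolution X).complex.linearYonedaObj R Y).iCycles n z = f ∧
    α = (projectiveResolution X).extMk f (n+1) rfl hf


variable {X Y : ModuleCat.{0} R} {n : ℕ}

lemma Rel.exists_right (x : ((Ext R (ModuleCat.{0} R) n).obj (op X)).obj Y) :
    ∃ α, Rel X Y n x α := by
  obtain ⟨z, hz⟩ := (ModuleCat.epi_iff_surjective
    (((projectiveResolution X).complex.linearYonedaObj R Y).homologyπ n)).1 inferInstance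
    (((projectiveResolution X).isoExt n Y).hom x)
  refine ⟨_, z, _, ?_, hz.symm, rfl, rfl⟩
  have := congrArg (fun t => t.hom z) (((projectiveResolution X).complex.linearYonedaObj R Y).iCycles_d n (n+1))
  exact this

lemma Rel.exists_left (α : Abelian.Ext X Y n) :
    ∃ x, Rel X Y n x α := by
  obtain ⟨f, hf, rfl⟩ := (projectiveResolution X).extMk_surjective α (n+1) rfl
  let K := ((projectiveResolution X).complex.linearYonedaObj R Y)
  have hK : K.d n (n+1) f = 0 := hf
  have : ∃ z : K.cycles n, K.iCycles n z = f := by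
    have hex : (ShortComplex.mk (K.iCycles n) (K.d n (n+1)) (by simp)).Exact :=
      ShortComplex.exact_of_f_is_kernel _ (K.cyclesIsKernel n (n+1) (by simp))
    exact (ShortComplex.moduleCat_exact_iff _).1 hex f hK
  obtain ⟨z, hz⟩ := this
  refine ⟨((projectiveResolution X).isoExt n Y).inv (K.homologyπ n z), z, f, hf, ?_, hz, rfl⟩
  simp [K]

lemma Rel.eq_zero_iff {x : ((Ext R (ModuleCat.{0} R) (n+1)).obj (op X)).obj Y}
    {α : Abelian.Ext X Y (n+1)} (h : Rel X Y (n+1) x α) : x = 0 ↔ α = 0 := by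
  obtain ⟨z, f, hf, h1, h2, rfl⟩ := h
  let K := ((projectiveResolution X).complex.linearYonedaObj R Y)
  rw [ProjectiveResolution.extMk_eq_zero_iff _ _ _ _ _ n rfl]
  have hx : x = 0 ↔ ((projectiveResolution X).isoExt (n+1) Y).hom x = 0 := by
    constructor
    · rintro rfl; simp
    · intro h
      have := congrArg (((projectiveResolution X).isoExt (n+1) Y).inv) h
      simpa using this
  rw [hx, h1]
  have hex : (ShortComplex.mk (K.toCycles n (n+1)) (K.homologyπ (n+1)) (by simp)).Exact :=
    ShortComplex.exact_of_g_is_cokernel _ (K.homologyIsCokernel n (n+1) (by simp))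
  have hi : Function.Injective (K.iCycles (n+1)) :=
    (ModuleCat.mono_iff_injective _).1 inferInstance
  have hc : ∀ g, K.iCycles (n+1) (K.toCycles n (n+1) g) = K.d n (n+1) g := by
    intro g
    exact congrArg (fun t => t.hom g) (K.toCycles_i n (n+1))
  constructor
  · intro h
    obtain ⟨g, hg⟩ := (ShortComplex.moduleCat_exact_iff _).1 hex z h
    refine ⟨g, ?_⟩
    rw [← h2, ← hg]
    exact (hc g).symm
  · rintro ⟨g, hg⟩
    have : K.toCycles n (n+1) g = z := by
      apply hi
      rw [hc g, h2, ← hg]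
      rfl
    rw [← this]
    exact congrArg (fun t => t.hom g) (K.toCycles_comp_homologyπ n (n+1))

lemma Rel.map {X' : ModuleCat.{0} R} (g : X' ⟶ X)
    {x : ((Ext R (ModuleCat.{0} R) n).obj (op X)).obj Y}
    {α : Abelian.Ext X Y n} (h : Rel X Y n x α) :
    Rel X' Y n (((Ext R (ModuleCat.{0} R) n).map g.op).app Y x)
      ((Abelian.Ext.mk₀ g).comp α (zero_add _)) := by
  obtain ⟨z, f, hf, h1, h2, rfl⟩ := h
  let φ := ProjectiveResolution.lift g (projectiveResolution X') (projectiveResolution X)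
  have hφ := ProjectiveResolution.lift_commutes_zero g (projectiveResolution X') (projectiveResolution X)
  have hn := isoExt_natural g (projectiveResolution X') (projectiveResolution X) φ hφ n Y
  refine ⟨HomologicalComplex.cyclesMap (homMap φ Y) n z, φ.f n ≫ f, ?_, ?_, ?_, ?_⟩
  · rw [← φ.comm_assoc, hf, comp_zero]
  · refine (congrArg (fun t => t.hom x) hn).trans ?_
    refine (congrArg (HomologicalComplex.homologyMap (homMap φ Y) n) h1).trans ?_
    exact (congrArg (fun t => t.hom z) (HomologicalComplex.homologyπ_naturality (homMap φ Y) n))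
  · refine (congrArg (fun t => t.hom z) (HomologicalComplex.cyclesMap_i (homMap φ Y) n)).trans ?_
    rw [← h2]; rfl
  · exact ProjectiveResolution.mk₀_comp_extMk f (n+1) rfl hf ⟨φ, by simpa using hφ⟩

lemma Rel.smul (c : R)
    {x : ((Ext R (ModuleCat.{0} R) n).obj (op X)).obj Y}
    {α : Abelian.Ext X Y n} (h : Rel X Y n x α) :
    Rel X Y n (c • x) (c • α) := by
  obtain ⟨z, f, hf, h1, h2, rfl⟩ := h
  refine ⟨c • z, c • f, by simp [hf], ?_, ?_, ?_⟩
  · rw [map_smul, map_smul, h1]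
  · rw [map_smul, h2]; rfl
  · rw [Abelian.Ext.smul_eq_comp_mk₀, ProjectiveResolution.extMk_comp_mk₀]
    simp


/-- The transition maps between the quotients by powers. -/
def tr (a : Ideal R) {t s : ℕ} (h : t ≤ s) :
    ModuleCat.of R (R ⧸ a ^ s) ⟶ ModuleCat.of R (R ⧸ a ^ t) :=
  (localCohomology.ringModIdeals (localCohomology.idealPowersDiagram a)).map (homOfLE h).op

lemma tr_mk (a : Ideal R) {t s : ℕ} (h : t ≤ s) (r : R) :
    tr a h (Ideal.Quotient.mk (a ^ s) r) = Ideal.Quotient.mk (a ^ t) r := rfl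

lemma tr_tr (a : Ideal R) {t s u : ℕ} (h : t ≤ s) (h' : s ≤ u) :
    tr a h' ≫ tr a h = tr a (h.trans h') := by
  exact ((localCohomology.ringModIdeals (localCohomology.idealPowersDiagram a)).map_comp
    (homOfLE h').op (homOfLE h).op).symm

/-- `c` kills the local cohomology of `M` in degree `i`, in terms of `Abelian.Ext`. -/
def Kil (a : Ideal R) (c : R) (i : ℕ) (M : ModuleCat.{0} R) : Prop :=
  ∀ (t : ℕ) (x : Abelian.Ext (ModuleCat.of R (R ⧸ a ^ t)) M i), ∃ (s : ℕ) (h : t ≤ s),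
    (Abelian.Ext.mk₀ (tr a h)).comp (c • x) (zero_add i) = 0

lemma mem_ann_iff (a : Ideal R) (c : R) (i : ℕ) (M : ModuleCat.{0} R) :
    c ∈ Module.annihilator R ((localCohomology a (i+1)).obj M) ↔ Kil a c (i+1) M := by
  let F := localCohomology.diagram (localCohomology.idealPowersDiagram a) (i+1)
  have hF : HasColimit F := localCohomology.hasColimitDiagram.{0,0} _ _
  let hc : IsColimit (((evaluation _ _).obj M).mapCocone (colimit.cocone F)) :=
    isColimitOfPreserves ((evaluation _ _).obj M) (colimit.isColimit F)
  let ι := fun t : ℕ => ((colimit.ι F (op (op t))).app M : ((F.obj (op (op t))).obj M) ⟶ (localCohomology a (i+1)).obj M)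
  have surj : ∀ y : (localCohomology a (i+1)).obj M, ∃ t x, ι t x = y := by
    intro y
    obtain ⟨t, x, h⟩ := Concrete.isColimit_exists_rep _ hc y
    exact ⟨t.unop.unop, x, h⟩
  have zero : ∀ t x, ι t x = 0 ↔ ∃ (s : ℕ) (h : t ≤ s), (F.map (homOfLE h).op.op).app M x = 0 := by
    intro t x
    constructor
    · intro h
      have := (Concrete.isColimit_rep_eq_iff_exists _ hc x (0 : (F.obj (op (op t))).obj M)).1
        (h.trans (map_zero _).symm)
      obtain ⟨k, f, g, hk⟩ := this
      refine ⟨k.unop.unop, f.unop.unop.down.down, ?_⟩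
      refine Eq.trans ?_ (hk.trans (map_zero _))
      rfl
    · rintro ⟨s, h, hx⟩
      have : ι t = (F.map (homOfLE h).op.op).app M ≫ ι s := by
        have := colimit.w F (homOfLE h).op.op
        exact (congrArg (fun f => f.app M) this).symm
      rw [this]
      exact (congrArg (ι s) hx).trans (map_zero _)
  rw [Module.mem_annihilator]
  constructor
  · intro h t α
    obtain ⟨x, hx⟩ := Rel.exists_left α
    have h1 : ι t (c • x) = 0 := (map_smul (ι t).hom c x).trans (h _)
    obtain ⟨s, hs, h2⟩ := (zero _ _).1 h1
    exact ⟨s, hs, ((hx.smul c).map (tr a hs)).eq_zero_iff.1 h2⟩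
  · intro h y
    obtain ⟨t, x, rfl⟩ := surj y
    obtain ⟨α, hα⟩ := Rel.exists_right x
    obtain ⟨s, hs, h2⟩ := h t α
    refine (map_smul (ι t).hom c x).symm.trans ?_
    exact (zero _ _).2 ⟨s, hs, ((hα.smul c).map (tr a hs)).eq_zero_iff.2 h2⟩

/-- Pullback of an `Ext` class along a transition map. -/
def pb (a : Ideal R) {M : ModuleCat.{0} R} {i t s : ℕ} (h : t ≤ s)
    (x : Abelian.Ext (ModuleCat.of R (R ⧸ a ^ t)) M i) :
    Abelian.Ext (ModuleCat.of R (R ⧸ a ^ s)) M i :=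
  (Abelian.Ext.mk₀ (tr a h)).comp x (zero_add i)

lemma pb_pb (a : Ideal R) {M : ModuleCat.{0} R} {i t s u : ℕ} (h : t ≤ s) (h' : s ≤ u)
    (x : Abelian.Ext (ModuleCat.of R (R ⧸ a ^ t)) M i) :
    pb a h' (pb a h x) = pb a (h.trans h') x := by
  unfold pb
  rw [Abelian.Ext.mk₀_comp_mk₀_assoc, tr_tr]

lemma pb_comp (a : Ideal R) {M N : ModuleCat.{0} R} {i j k t s : ℕ} (h : t ≤ s)
    (x : Abelian.Ext (ModuleCat.of R (R ⧸ a ^ t)) M i) (y : Abelian.Ext M N j) (hk : i + j = k) :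
    pb a h (x.comp y hk) = (pb a h x).comp y hk := by
  unfold pb
  rw [Abelian.Ext.comp_assoc]
  omega

lemma pb_smul (a : Ideal R) {M : ModuleCat.{0} R} {i t s : ℕ} (h : t ≤ s) (c : R)
    (x : Abelian.Ext (ModuleCat.of R (R ⧸ a ^ t)) M i) :
    pb a h (c • x) = c • pb a h x := by
  unfold pb
  rw [Abelian.Ext.comp_smul]

lemma pb_zero (a : Ideal R) {M : ModuleCat.{0} R} {i t s : ℕ} (h : t ≤ s) :
    pb a h (0 : Abelian.Ext (ModuleCat.of R (R ⧸ a ^ t)) M i) = 0 := by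
  unfold pb
  rw [Abelian.Ext.comp_zero]

/-- The local cohomology of `M` vanishes in degree `i`. -/
abbrev Van (a : Ideal R) (i : ℕ) (M : ModuleCat.{0} R) : Prop := Kil a 1 i M

lemma Van.exists {a : Ideal R} {i : ℕ} {M : ModuleCat.{0} R} (h : Van a i M) {t : ℕ}
    (x : Abelian.Ext (ModuleCat.of R (R ⧸ a ^ t)) M i) : ∃ (s : ℕ) (h : t ≤ s), pb a h x = 0 := by
  obtain ⟨s, hs, h⟩ := h t x
  rw [one_smul] at h
  exact ⟨s, hs, h⟩

lemma Van.mk {a : Ideal R} {i : ℕ} {M : ModuleCat.{0} R}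
    (h : ∀ (t : ℕ) (x : Abelian.Ext (ModuleCat.of R (R ⧸ a ^ t)) M i),
      ∃ (s : ℕ) (h : t ≤ s), pb a h x = 0) : Van a i M := by
  intro t x
  rw [one_smul]
  exact h t x

lemma Kil.exists {a : Ideal R} {c : R} {i : ℕ} {M : ModuleCat.{0} R} (h : Kil a c i M) {t : ℕ}
    (x : Abelian.Ext (ModuleCat.of R (R ⧸ a ^ t)) M i) :
    ∃ (s : ℕ) (h : t ≤ s), c • pb a h x = 0 := by
  obtain ⟨s, hs, h⟩ := h t x
  exact ⟨s, hs, (pb_smul a hs c x).symm.trans h⟩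

lemma Kil.mk {a : Ideal R} {c : R} {i : ℕ} {M : ModuleCat.{0} R}
    (h : ∀ (t : ℕ) (x : Abelian.Ext (ModuleCat.of R (R ⧸ a ^ t)) M i),
      ∃ (s : ℕ) (h : t ≤ s), c • pb a h x = 0) : Kil a c i M := by
  intro t x
  obtain ⟨s, hs, h⟩ := h t x
  exact ⟨s, hs, (pb_smul a hs c x).trans h⟩

section chase
variable {a : Ideal R} {S : ShortComplex (ModuleCat.{0} R)}

lemma van_mid (hS : S.ShortExact) {i : ℕ} (h1 : Van a i S.X₁) (h3 : Van a i S.X₃) : Van a i S.X₂ := by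
  refine Van.mk fun t x => ?_
  obtain ⟨s, hs, h⟩ := h3.exists (x.comp (Abelian.Ext.mk₀ S.g) (add_zero i))
  rw [pb_comp] at h
  obtain ⟨y, hy⟩ := Abelian.Ext.covariant_sequence_exact₂ _ hS _ h
  obtain ⟨u, hu, h'⟩ := h1.exists y
  refine ⟨u, hs.trans hu, ?_⟩
  rw [← pb_pb a hs hu, ← hy, pb_comp, h', Abelian.Ext.zero_comp]

lemma kil_right (hS : S.ShortExact) {i : ℕ} {c : R} (h2 : Kil a c i S.X₂) (h1 : Van a (i+1) S.X₁) :
    Kil a c i S.X₃ := by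
  refine Kil.mk fun t x => ?_
  obtain ⟨s, hs, h⟩ := h1.exists (x.comp hS.extClass rfl)
  rw [pb_comp] at h
  obtain ⟨y, hy⟩ := Abelian.Ext.covariant_sequence_exact₃ _ hS _ rfl h
  obtain ⟨u, hu, h'⟩ := h2.exists y
  refine ⟨u, hs.trans hu, ?_⟩
  rw [← pb_pb a hs hu, ← hy, pb_comp, ← Abelian.Ext.smul_comp, h', Abelian.Ext.zero_comp]

lemma van_left (hS : S.ShortExact) {i : ℕ} (h2 : Van a (i+1) S.X₂) (h3 : Van a i S.X₃) : Van a (i+1) S.X₁ := by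
  refine Van.mk fun t x => ?_
  obtain ⟨s, hs, h⟩ := h2.exists (x.comp (Abelian.Ext.mk₀ S.f) (add_zero _))
  rw [pb_comp] at h
  obtain ⟨y, hy⟩ := Abelian.Ext.covariant_sequence_exact₁ _ hS _ h rfl
  obtain ⟨u, hu, h'⟩ := h3.exists y
  refine ⟨u, hs.trans hu, ?_⟩
  rw [← pb_pb a hs hu, ← hy, pb_comp, h', Abelian.Ext.zero_comp]

end chase

/-- The `a`-power torsion submodule. -/
def tors (a : Ideal R) (M : Type) [AddCommGroup M] [Module R M] : Submodule R M where
  carrier := {x | ∃ k : ℕ, ∀ c ∈ a ^ k, c • x = 0}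
  zero_mem' := ⟨0, fun c _ => smul_zero c⟩
  add_mem' := by
    rintro x y ⟨k, hk⟩ ⟨l, hl⟩
    refine ⟨max k l, fun c hc => ?_⟩
    rw [smul_add, hk c (Ideal.pow_le_pow_right (le_max_left _ _) hc),
      hl c (Ideal.pow_le_pow_right (le_max_right _ _) hc), add_zero]
  smul_mem' := by
    rintro r x ⟨k, hk⟩
    exact ⟨k, fun c hc => by rw [smul_comm, hk c hc, smul_zero]⟩

lemma mem_tors {a : Ideal R} {M : Type} [AddCommGroup M] [Module R M] {x : M} :
    x ∈ tors a M ↔ ∃ k : ℕ, ∀ c ∈ a ^ k, c • x = 0 := Iff.rfl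

lemma tors_uniform (a : Ideal R) {M : Type} [AddCommGroup M] [Module R M] (W : Submodule R M)
    (hW : W.FG) : W ≤ tors a M → ∃ k : ℕ, ∀ c ∈ a ^ k, ∀ w ∈ W, c • w = 0 := by
  induction W, hW using Submodule.fg_induction with
  | singleton x =>
    intro h
    obtain ⟨k, hk⟩ := h (Submodule.mem_span_singleton_self x)
    refine ⟨k, fun c hc w hw => ?_⟩
    obtain ⟨r, rfl⟩ := Submodule.mem_span_singleton.1 hw
    rw [smul_comm, hk c hc, smul_zero]
  | sup W₁ W₂ _ _ h1 h2 =>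
    intro h
    obtain ⟨k, hk⟩ := h1 (le_sup_left.trans h)
    obtain ⟨l, hl⟩ := h2 (le_sup_right.trans h)
    refine ⟨max k l, fun c hc w hw => ?_⟩
    obtain ⟨x, hx, y, hy, rfl⟩ := Submodule.mem_sup.1 hw
    rw [smul_add, hk c (Ideal.pow_le_pow_right (le_max_left _ _) hc) x hx,
      hl c (Ideal.pow_le_pow_right (le_max_right _ _) hc) y hy, add_zero]

/-- Over a Noetherian ring the torsion submodule of an injective module is injective. -/
lemma tors_baer [IsNoetherianRing R] (a : Ideal R) (I : Type) [AddCommGroup I] [Module R I]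
    [hI : Module.Injective R I] : Module.Baer R (tors a I) := by
  intro J g
  obtain ⟨k, hk⟩ := tors_uniform a (LinearMap.range ((tors a I).subtype ∘ₗ g))
    (by rw [LinearMap.range_eq_map]; exact (Module.Finite.fg_top).map _) (by
      rintro _ ⟨x, rfl⟩
      exact (g x).2)
  obtain ⟨l, hl⟩ := Ideal.exists_pow_inf_eq_pow_smul a (M := R) J
  have key : ∀ x : J, (x : R) ∈ a ^ (k + l) → (g x : I) = 0 := by
    intro x hx
    have h1 : (x : R) ∈ a ^ (k + l) • (⊤ : Submodule R R) ⊓ J := ⟨by simpa using hx, x.2⟩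
    rw [hl _ (Nat.le_add_left _ _), Nat.add_sub_cancel] at h1
    have h2 : (x : R) ∈ a ^ k • J := Submodule.smul_mono le_rfl inf_le_right h1
    have h3 : ∀ y (hy : y ∈ a ^ k • J), ∃ hy' : y ∈ J, (g ⟨y, hy'⟩ : I) = 0 := by
      intro y hy
      refine Submodule.smul_induction_on hy ?_ ?_
      · intro c hc n hn
        refine ⟨J.smul_mem c hn, ?_⟩
        have : (⟨c • n, J.smul_mem c hn⟩ : J) = c • ⟨n, hn⟩ := rfl
        rw [this, map_smul]
        exact hk c hc _ ⟨⟨n, hn⟩, rfl⟩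
      · rintro y z ⟨hy, hy1⟩ ⟨hz, hz1⟩
        refine ⟨J.add_mem hy hz, ?_⟩
        have : (⟨y + z, J.add_mem hy hz⟩ : J) = ⟨y, hy⟩ + ⟨z, hz⟩ := rfl
        rw [this, map_add, Submodule.coe_add, hy1, hz1, add_zero]
    exact (h3 x h2).2
  let f1 : R →ₗ.[R] I := ⟨J, (tors a I).subtype ∘ₗ g⟩
  let f2 : R →ₗ.[R] I := ⟨a ^ (k + l), 0⟩
  have H : ∀ (x : f1.domain) (y : f2.domain), (x : R) = y → f1 x = f2 y := by
    intro x y hxy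
    exact key x (hxy ▸ y.2)
  obtain ⟨h, hh⟩ := (Module.Baer.of_injective hI) _ (f1.sup f2 H).toFun
  have hJ : ∀ x : J, h x = g x := by
    intro x
    rw [hh x (le_sup_left (a := f1.domain) x.2)]
    exact ((f1.left_le_sup f2 H).2 rfl).symm
  have ha : ∀ x ∈ a ^ (k + l), h x = 0 := by
    intro x hx
    rw [hh x (le_sup_right (b := f2.domain) hx)]
    exact ((f1.right_le_sup f2 H).2 (x := ⟨x, hx⟩) rfl).symm
  have h1 : h 1 ∈ tors a I := ⟨k + l, fun c hc => by
    rw [← map_smul, smul_eq_mul, mul_one, ha c hc]⟩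
  refine ⟨LinearMap.toSpanSingleton R _ ⟨h 1, h1⟩, fun x hx => Subtype.ext ?_⟩
  rw [← hJ ⟨x, hx⟩]
  simp [← map_smul]

lemma van_injective (a : Ideal R) (i : ℕ) (M : ModuleCat.{0} R) [Injective M] :
    Van a (i+1) M :=
  Van.mk fun t x => ⟨t, le_rfl, by rw [Abelian.Ext.eq_zero_of_injective x, pb_zero]⟩

lemma tors_embed [IsNoetherianRing R] (a : Ideal R) (N : ModuleCat.{0} R)
    (hN : tors a N = ⊤) : ∃ (S : ShortComplex (ModuleCat.{0} R)), S.ShortExact ∧ S.X₁ = N ∧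
      Injective S.X₂ ∧ tors a S.X₂ = ⊤ ∧ tors a S.X₃ = ⊤ := by
  let I := Injective.under N
  have hI : Module.Injective R I := by
    have : Injective (ModuleCat.of R I) := inferInstanceAs (Injective (Injective.under N))
    exact Module.injective_module_of_injective_object R I
  let E := tors a I
  have hE : Injective (ModuleCat.of R E) := by
    have := (tors_baer a I).injective
    exact Module.injective_object_of_injective_module R E
  have hmem : ∀ x : N, (Injective.ι N).hom x ∈ E := by
    intro x
    have hx : x ∈ tors a N := by rw [hN]; trivial
    obtain ⟨k, hk⟩ := hx
    exact ⟨k, fun c hc => by rw [← map_smul, hk c hc, map_zero]⟩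
  let f : N →ₗ[R] E := (Injective.ι N).hom.codRestrict E hmem
  have hf : Function.Injective f := by
    intro x y hxy
    have : Function.Injective (Injective.ι N) := (ModuleCat.mono_iff_injective _).1 inferInstance
    exact this (congrArg Subtype.val hxy)
  let S := ModuleCat.shortComplexOfCompEqZero f (LinearMap.range f).mkQ (LinearMap.range_mkQ_comp f)
  have hEt : tors a E = ⊤ := by
    rw [eq_top_iff]
    rintro ⟨x, k, hk⟩ -
    exact ⟨k, fun c hc => Subtype.ext (hk c hc)⟩
  refine ⟨S, ModuleCat.shortComplex_shortExact S ?_ hf (Submodule.mkQ_surjective _), rfl, hE,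
    hEt, ?_⟩
  · exact LinearMap.exact_map_mkQ_range f
  · rw [eq_top_iff]
    intro x _
    obtain ⟨e, rfl⟩ := Submodule.mkQ_surjective _ x
    have he : e ∈ tors a E := by rw [hEt]; trivial
    obtain ⟨k, hk⟩ := he
    exact ⟨k, fun c hc => by rw [← map_smul, hk c hc, map_zero]⟩

/-- `a`-power torsion modules are acyclic. -/
lemma van_tors [IsNoetherianRing R] (a : Ideal R) (i : ℕ) : ∀ (N : ModuleCat.{0} R),
    tors a N = ⊤ → Van a (i+1) N := by
  induction i with
  | zero =>
    intro N hN
    obtain ⟨S, hS, rfl, hinj, h2, h3⟩ := tors_embed a N hN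
    refine Van.mk fun t x => ?_
    obtain ⟨z, rfl⟩ := Abelian.Ext.covariant_sequence_exact₁ _ hS x
      (Abelian.Ext.eq_zero_of_injective _) rfl
    obtain ⟨h, rfl⟩ := Abelian.Ext.mk₀_bijective _ _ |>.2 z
    obtain ⟨e, he⟩ := hS.moduleCat_surjective_g (h.hom (Submodule.Quotient.mk (1 : R)))
    have het : e ∈ tors a S.X₂ := by rw [h2]; trivial
    obtain ⟨k, hk⟩ := het
    let s := max t k
    let l : ModuleCat.of R (R ⧸ a ^ s) ⟶ S.X₂ := ModuleCat.ofHom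
      (Submodule.liftQ (a ^ s) (LinearMap.toSpanSingleton R _ e) (by
        intro c hc
        exact hk c (Ideal.pow_le_pow_right (le_max_right t k) hc)))
    have hl : tr a (le_max_left t k) ≫ h = l ≫ S.g := by
      refine ModuleCat.hom_ext (LinearMap.ext fun y => ?_)
      obtain ⟨r, rfl⟩ := Submodule.mkQ_surjective _ y
      change h.hom (Submodule.Quotient.mk r) = S.g.hom (r • e)
      rw [map_smul]
      have : (Submodule.Quotient.mk r : R ⧸ a ^ t) = r • Submodule.Quotient.mk (1 : R) := by
        rw [← Submodule.Quotient.mk_smul, smul_eq_mul, mul_one]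
      rw [this]
      refine (map_smul h.hom r _).trans ?_
      exact congrArg (r • ·) he.symm
    refine ⟨s, le_max_left t k, ?_⟩
    rw [pb_comp, pb, Abelian.Ext.mk₀_comp_mk₀, hl, ← Abelian.Ext.mk₀_comp_mk₀,
      Abelian.Ext.comp_assoc (h₂₃ := zero_add 1) (h := by omega), hS.comp_extClass,
      Abelian.Ext.comp_zero]
  | succ i ih =>
    intro N hN
    obtain ⟨S, hS, rfl, hinj, h2, h3⟩ := tors_embed a N hN
    exact van_left hS (van_injective a _ _) (ih _ h3)

lemma ses {A B C : Type} [AddCommGroup A] [Module R A] [AddCommGroup B] [Module R B]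
    [AddCommGroup C] [Module R C] {f : A →ₗ[R] B} {g : B →ₗ[R] C} (hf : Function.Injective f)
    (hg : Function.Surjective g) (h : Function.Exact f g) :
    (ModuleCat.shortComplexOfCompEqZero f g h.linearMap_comp_eq_zero).ShortExact :=
  ModuleCat.shortComplex_shortExact _ h hf hg

lemma exact_smul (J : Ideal R) (y : R) :
    Function.Exact (y • LinearMap.id : (R ⧸ J) →ₗ[R] R ⧸ J)
      (Submodule.factor (le_sup_left : J ≤ J ⊔ Ideal.span {y})) := by
  intro x
  obtain ⟨r, rfl⟩ := Submodule.mkQ_surjective _ x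
  have h1 : Submodule.factor (le_sup_left : J ≤ J ⊔ Ideal.span {y}) (J.mkQ r) = 0 ↔
    r ∈ J ⊔ Ideal.span {y} := Submodule.Quotient.mk_eq_zero _
  rw [h1]
  constructor
  · intro h
    obtain ⟨j, hj, z, hz, rfl⟩ := Submodule.mem_sup.1 h
    obtain ⟨w, rfl⟩ := Ideal.mem_span_singleton'.1 hz
    refine ⟨J.mkQ w, ?_⟩
    have : J.mkQ j = 0 := (Submodule.Quotient.mk_eq_zero _).2 hj
    rw [map_add, this, zero_add, mul_comm, ← smul_eq_mul, map_smul]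
    rfl
  · rintro ⟨x, hx⟩
    obtain ⟨w, rfl⟩ := Submodule.mkQ_surjective _ x
    have : y * w - r ∈ J := (Submodule.Quotient.eq J).1 hx
    have h2 : r = -(y * w - r) + w * y := by ring
    rw [h2]
    exact add_mem (neg_mem (Ideal.mem_sup_left this))
      (Ideal.mem_sup_right (Ideal.mul_mem_left _ _ (Ideal.mem_span_singleton_self y)))

lemma exact_tors (a J : Ideal R) (J' : Ideal R) (hJ : J ≤ J')
    (h : J' = (tors a (R ⧸ J)).comap J.mkQ) :
    Function.Exact (tors a (R ⧸ J)).subtype (Submodule.factor hJ) := by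
  intro x
  obtain ⟨r, rfl⟩ := Submodule.mkQ_surjective _ x
  have h1 : Submodule.factor hJ (J.mkQ r) = 0 ↔ r ∈ J' := Submodule.Quotient.mk_eq_zero _
  rw [h1, h]
  constructor
  · intro h
    exact ⟨⟨_, h⟩, rfl⟩
  · rintro ⟨x, hx⟩
    exact Submodule.mem_comap.2 (hx ▸ x.2)

lemma kil_iso {a : Ideal R} {c : R} {i : ℕ} {M N : ModuleCat.{0} R} (e : M ≅ N)
    (h : Kil a c i M) : Kil a c i N := by
  refine Kil.mk fun t x => ?_
  obtain ⟨s, hs, h1⟩ := h.exists (x.comp (Abelian.Ext.mk₀ e.inv) (add_zero i))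
  refine ⟨s, hs, ?_⟩
  have : x = (x.comp (Abelian.Ext.mk₀ e.inv) (add_zero i)).comp (Abelian.Ext.mk₀ e.hom)
      (add_zero i) := by
    rw [Abelian.Ext.comp_assoc (h₂₃ := add_zero 0) (h := by omega), Abelian.Ext.mk₀_comp_mk₀,
      e.inv_hom_id, Abelian.Ext.comp_mk₀_id]
  rw [this, pb_comp, ← Abelian.Ext.smul_comp, h1, Abelian.Ext.zero_comp]

/-- Multiplication by a regular element. -/
lemma caseB {a J : Ideal R} {y : R}
    (hy : Function.Injective (y • LinearMap.id : (R ⧸ J) →ₗ[R] R ⧸ J)) {i : ℕ}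
    (h3 : Van a i (ModuleCat.of R (R ⧸ (J ⊔ Ideal.span {y}))))
    (h : Kil a y i (ModuleCat.of R (R ⧸ J))) : Van a i (ModuleCat.of R (R ⧸ J)) := by
  have hS := ses hy (Submodule.factor_surjective _) (exact_smul J y)
  refine Van.mk fun t x => ?_
  obtain ⟨s, hs, h1⟩ := h3.exists (x.comp (Abelian.Ext.mk₀
    (ModuleCat.shortComplexOfCompEqZero _ _ (exact_smul J y).linearMap_comp_eq_zero).g)
    (add_zero i))
  rw [pb_comp] at h1
  obtain ⟨z, hz⟩ := Abelian.Ext.covariant_sequence_exact₂ _ hS _ h1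
  have hz' : y • z = pb a hs x := by
    rw [← hz, Abelian.Ext.smul_eq_comp_mk₀]
    rfl
  obtain ⟨u, hu, h2⟩ := h.exists z
  refine ⟨u, hs.trans hu, ?_⟩
  rw [← pb_pb a hs hu, ← hz', pb_smul, h2]

lemma exists_regular [IsNoetherianRing R] (a : Ideal R) (M : Type) [AddCommGroup M] [Module R M]
    [Module.Finite R M] (h : tors a M = ⊥) : ∃ y ∈ a, ∀ x : M, y • x = 0 → x = 0 := by
  by_contra! hc
  have h1 : (a : Set R) ⊆ ⋃ p ∈ associatedPrimes R M, (p : Set R) := by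
    rw [biUnion_associatedPrimes_eq_zero_divisors]
    intro y hy
    obtain ⟨x, hx, hx'⟩ := hc y hy
    exact ⟨x, hx', hx⟩
  obtain ⟨p, hp, hap⟩ := (Ideal.subset_union_prime_finite (associatedPrimes.finite R M)
    (f := fun p => p) ⊤ ⊤ (fun p hp _ _ => hp.1)).1 h1
  obtain ⟨hpp, f, hf⟩ := (isAssociatedPrime_iff_exists_injective_linearMap p M).1 hp
  have hm : f (Submodule.Quotient.mk 1) ∈ tors a M := by
    refine ⟨1, fun c hc => ?_⟩
    rw [pow_one] at hc
    rw [← map_smul, ← Submodule.Quotient.mk_smul, smul_eq_mul, mul_one,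
      (Submodule.Quotient.mk_eq_zero p).2 (hap hc), map_zero]
  rw [h, Submodule.mem_bot] at hm
  have h0 : (Submodule.Quotient.mk 1 : R ⧸ p) = 0 := hf (hm.trans (map_zero f).symm)
  exact hpp.ne_top ((Ideal.eq_top_iff_one p).2 ((Submodule.Quotient.mk_eq_zero p).1 h0))

lemma main_ind [IsNoetherianRing R] (a : Ideal R) (k : ℕ) (J : Ideal R) :
    (∀ c ∈ a ^ k, Kil a c 1 (ModuleCat.of R (R ⧸ J))) →
    (∀ i, Van a (i + 2) (ModuleCat.of R (R ⧸ J))) → Van a 1 (ModuleCat.of R (R ⧸ J)) := by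
  induction J using WellFoundedGT.induction with
  | ind J ih =>
  intro hk hv
  by_cases ht : tors a (R ⧸ J) = ⊤
  · exact van_tors a 0 _ ht
  by_cases hb : tors a (R ⧸ J) = ⊥
  · obtain ⟨y, hya, hy⟩ := exists_regular a (R ⧸ J) hb
    have hyk : ∀ (n : ℕ) (x : R ⧸ J), y ^ n • x = 0 → x = 0 := by
      intro n
      induction n with
      | zero => intro x hx; simpa using hx
      | succ n ihn =>
        intro x hx
        rw [pow_succ, mul_smul] at hx
        exact hy _ (ihn _ hx)
    have hinj : Function.Injective (y ^ k • LinearMap.id : (R ⧸ J) →ₗ[R] R ⧸ J) := by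
      rw [injective_iff_map_eq_zero]
      exact hyk k
    have hlt : J < J ⊔ Ideal.span {y ^ k} := by
      refine left_lt_sup.2 fun hle => ht ?_
      have hmem : y ^ k ∈ J := hle (Ideal.mem_span_singleton_self _)
      rw [eq_top_iff]
      intro x _
      have : x = 0 := by
        apply hyk k
        obtain ⟨r, rfl⟩ := Submodule.mkQ_surjective _ x
        rw [← map_smul]
        exact (Submodule.Quotient.mk_eq_zero _).2 (J.mul_mem_right r hmem)
      rw [this]
      exact zero_mem _
    have hS := ses hinj (Submodule.factor_surjective _) (exact_smul J (y ^ k))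
    have h3 := ih _ hlt (fun c hc => kil_right hS (hk c hc) (hv 0))
      (fun i => kil_right hS (hv i) (hv (i + 1)))
    exact caseB hinj h3 (hk _ (Ideal.pow_mem_pow hya k))
  · let J' : Ideal R := (tors a (R ⧸ J)).comap J.mkQ
    have hle : J ≤ J' := by
      intro r hr
      have : J.mkQ r = 0 := (Submodule.Quotient.mk_eq_zero _).2 hr
      rw [Submodule.mem_comap, this]
      exact zero_mem _
    have hlt : J < J' := by
      refine lt_of_le_not_ge hle fun hge => hb ?_
      rw [eq_bot_iff]
      intro x hx
      obtain ⟨r, rfl⟩ := Submodule.mkQ_surjective _ x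
      exact (Submodule.Quotient.mk_eq_zero _).2 (hge hx)
    have hT : tors a (tors a (R ⧸ J)) = ⊤ := by
      rw [eq_top_iff]
      rintro ⟨x, k, hk⟩ -
      exact ⟨k, fun c hc => Subtype.ext (hk c hc)⟩
    have hS := ses (Submodule.injective_subtype _) (Submodule.factor_surjective hle)
      (exact_tors a J J' hle rfl)
    have hvT : ∀ i, Van a (i + 1) (ModuleCat.of R (tors a (R ⧸ J))) :=
      fun i => van_tors a i _ hT
    have h3 := ih _ hlt (fun c hc => kil_right hS (hk c hc) (hvT 1))
      (fun i => kil_right hS (hv i) (hvT (i + 2)))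
    exact van_mid hS (hvT 0) h3

lemma kil_pow [IsNoetherianRing R] [IsDomain R] (a : Ideal R) {r : R} (hr : r ≠ 0)
    (h : Kil a r 1 (ModuleCat.of R (R ⧸ (⊥ : Ideal R)))) :
    ∃ k : ℕ, ∀ c ∈ a ^ k, Kil a c 1 (ModuleCat.of R (R ⧸ (⊥ : Ideal R))) := by
  have hinj : Function.Injective (r • LinearMap.id : (R ⧸ (⊥ : Ideal R)) →ₗ[R] _) := by
    rw [injective_iff_map_eq_zero]
    intro x hx
    obtain ⟨w, rfl⟩ := Submodule.mkQ_surjective _ x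
    have h1 : r * w ∈ (⊥ : Ideal R) := (Submodule.Quotient.mk_eq_zero (⊥ : Ideal R)).1 hx
    have h2 : w = 0 := (mul_eq_zero.1 ((Submodule.mem_bot R).1 h1)).resolve_left hr
    rw [h2, map_zero]
  have hS := ses hinj (Submodule.factor_surjective _) (exact_smul ⊥ r)
  obtain ⟨k, hk⟩ := tors_uniform a (tors a (R ⧸ (⊥ ⊔ Ideal.span {r} : Ideal R)))
    (IsNoetherian.noetherian _) le_rfl
  refine ⟨k, fun c hc => Kil.mk fun t x => ?_⟩
  obtain ⟨s, hs, h1⟩ := h.exists x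
  have h2 : (pb a hs x).comp (Abelian.Ext.mk₀ (ModuleCat.shortComplexOfCompEqZero _ _
      (exact_smul ⊥ r).linearMap_comp_eq_zero).f) (add_zero 1) = 0 := by
    rw [← h1, Abelian.Ext.smul_eq_comp_mk₀]
    rfl
  obtain ⟨z, hz⟩ := Abelian.Ext.covariant_sequence_exact₁ _ hS _ h2 rfl
  obtain ⟨g, rfl⟩ := Abelian.Ext.mk₀_bijective _ _ |>.2 z
  refine ⟨s, hs, ?_⟩
  have hg : c • g = 0 := by
    refine ModuleCat.hom_ext (LinearMap.ext fun y => ?_)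
    refine hk c hc (g.hom y) ⟨s, fun d hd => ?_⟩
    obtain ⟨w, rfl⟩ := Submodule.mkQ_surjective _ y
    have h3 : d • (a ^ s).mkQ w = 0 := by
      rw [← map_smul]
      exact (Submodule.Quotient.mk_eq_zero _).2 ((a ^ s).mul_mem_right w hd)
    exact (map_smul g.hom d _).symm.trans ((congrArg g.hom h3).trans (map_zero _))
  rw [← hz, ← Abelian.Ext.smul_comp, ← Abelian.Ext.mk₀_smul, hg, Abelian.Ext.mk₀_zero,
    Abelian.Ext.zero_comp]

end
end LC

theorem stmt16 {R : Type} [CommRing R] [IsNoetherianRing R] [IsDomain R]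
    (a : Ideal R) (hcd : HasCD a (ModuleCat.of R R) 1) :
    Module.annihilator R ((localCohomology a 1).obj (ModuleCat.of R R)) = ⊥ := by
  by_contra hne
  obtain ⟨r, hr, hr0⟩ := Submodule.exists_mem_ne_zero_of_ne_bot hne
  obtain ⟨hnt, hsub⟩ := hcd
  let e : ModuleCat.of R R ≅ ModuleCat.of R (R ⧸ (⊥ : Ideal R)) :=
    (Submodule.quotEquivOfEqBot (⊥ : Ideal R) rfl).symm.toModuleIso
  have hv : ∀ i, LC.Van a (i + 2) (ModuleCat.of R (R ⧸ (⊥ : Ideal R))) := by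
    intro i
    refine LC.kil_iso e ((LC.mem_ann_iff a 1 (i + 1) _).1 ?_)
    have := hsub (i + 1 + 1) (by omega)
    exact Module.mem_annihilator.2 fun m => Subsingleton.elim _ _
  obtain ⟨k, hk⟩ := LC.kil_pow a hr0 (LC.kil_iso e ((LC.mem_ann_iff a r 0 _).1 hr))
  have h1 := (LC.mem_ann_iff a 1 0 _).2 (LC.kil_iso e.symm (LC.main_ind a k ⊥ hk hv))
  obtain ⟨m, hm⟩ := exists_ne (0 : (localCohomology a 1).obj (ModuleCat.of R R))
  exact hm ((one_smul R m).symm.trans (Module.mem_annihilator.1 h1 m))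
end

section
/- Let R be a Noetherian ring and 𝔞 an ideal with cd(𝔞, R) = 1. Then Att_R(H^1_𝔞(R)) = { 𝔭 ∈ Spec R : cd(𝔞, R/𝔭) = 1 }. -/
open CategoryTheory

/-- The attached primes of an `R`-module `A`: primes of the form `Ann_R(A/B)`. -/
def attachedPrimes (R : Type) [CommRing R] (A : Type) [AddCommGroup A] [Module R A] :
    Set (Ideal R) :=
  {p | p.IsPrime ∧ ∃ B : Submodule R A, p = Module.annihilator R (A ⧸ B)}

open CategoryTheory Limits Opposite

namespace LC

noncomputable section

variable {R : Type} [CommRing R]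

/-- the Hom complex of a projective resolution -/
abbrev homC {X : ModuleCat.{0} R} (P : ProjectiveResolution X) (Y : ModuleCat.{0} R) :
    CochainComplex (ModuleCat R) ℕ := P.complex.linearYonedaObj R Y

/-- postcomposition -/
def homCMapY {X : ModuleCat.{0} R} (P : ProjectiveResolution X) {Y Y' : ModuleCat.{0} R}
    (u : Y ⟶ Y') : homC P Y ⟶ homC P Y' :=
  (HomologicalComplex.unopFunctor _ _).map
    ((NatTrans.mapHomologicalComplex (NatTrans.rightOp ((linearYoneda R (ModuleCat.{0} R)).map u))
      (ComplexShape.down ℕ)).app P.complex).op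

/-- precomposition -/
def homCMapX {X X' : ModuleCat.{0} R} (P : ProjectiveResolution X) (P' : ProjectiveResolution X')
    (φ : P.complex ⟶ P'.complex) (Y : ModuleCat.{0} R) : homC P' Y ⟶ homC P Y :=
  (HomologicalComplex.unopFunctor _ _).map
    (((((linearYoneda R (ModuleCat.{0} R)).obj Y).rightOp.mapHomologicalComplex
      (ComplexShape.down ℕ)).map φ)).op

lemma homologyUnop_nat {K L : ChainComplex (ModuleCat.{0} R)ᵒᵖ ℕ} (φ : K ⟶ L) (n : ℕ) :
    HomologicalComplex.homologyMap ((HomologicalComplex.unopFunctor _ _).map φ.op) n ≫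
      (HomologicalComplex.homologyUnop K n).hom =
    (HomologicalComplex.homologyUnop L n).hom ≫ (HomologicalComplex.homologyMap φ n).unop := by
  have := HomologicalComplex.homologyOp_hom_naturality
    ((HomologicalComplex.unopFunctor _ _).map φ.op) n
  have h2 := congrArg Quiver.Hom.unop this
  change ((HomologicalComplex.homologyOp _ n).hom).unop ≫ (HomologicalComplex.homologyMap φ n).unop
    = HomologicalComplex.homologyMap ((HomologicalComplex.unopFunctor _ _).map φ.op) n ≫
    ((HomologicalComplex.homologyOp _ n).hom).unop at h2
  exact h2.symm

lemma sq_inv {C : Type*} [Category C] {A B A' B' : C} (e : A ≅ B) (e' : A' ≅ B') (f : A ⟶ A')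
    (g : B ⟶ B') (h : f ≫ e'.hom = e.hom ≫ g) : g ≫ e'.inv = e.inv ≫ f := by
  rw [Iso.comp_inv_eq, Category.assoc, h, Iso.inv_hom_id_assoc]

lemma genY {C : Type*} [Category C] {L L' H H' K K' : C} (i : L ⟶ H) (i' : L' ⟶ H') (j' : H' ⟶ L')
    (m : L ⟶ L') (k : H ⟶ H') (u : H ⟶ K) (u' : H' ⟶ K') (k' : K ⟶ K')
    (h1 : m = i ≫ k ≫ j') (h2 : j' ≫ i' = 𝟙 _) (h3 : k ≫ u' = u ≫ k') :
    m ≫ (i' ≫ u') = (i ≫ u) ≫ k' := by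
  rw [h1, Category.assoc, Category.assoc, ← Category.assoc j', h2, Category.id_comp, h3,
    Category.assoc]

lemma genX {C : Type*} [Category C] {L L' H H' K K' : C} (i : L ⟶ H) (i' : L' ⟶ H')
    (m : L ⟶ L') (k : H ⟶ H') (u : H ⟶ K) (u' : H' ⟶ K') (k' : K ⟶ K')
    (h1 : m ≫ i' = i ≫ k) (h3 : k ≫ u' = u ≫ k') :
    m ≫ (i' ≫ u') = (i ≫ u) ≫ k' := by
  rw [← Category.assoc, h1, Category.assoc, h3, Category.assoc]

lemma homologyUnop_nat' {K L : ChainComplex (ModuleCat.{0} R)ᵒᵖ ℕ} (φ : K ⟶ L) (n : ℕ) :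
    (HomologicalComplex.homologyMap φ n).unop ≫ (HomologicalComplex.homologyUnop K n).inv =
    (HomologicalComplex.homologyUnop L n).inv ≫
      HomologicalComplex.homologyMap ((HomologicalComplex.unopFunctor _ _).map φ.op) n := by
  exact sq_inv (HomologicalComplex.homologyUnop L n) (HomologicalComplex.homologyUnop K n) _ _
    (homologyUnop_nat φ n)

lemma isoExt_natY {X : ModuleCat.{0} R} (P : ProjectiveResolution X) {Y Y' : ModuleCat.{0} R}
    (u : Y ⟶ Y') (n : ℕ) :
    ((Ext R (ModuleCat.{0} R) n).obj (op X)).map u ≫ (P.isoExt (R := R) n Y').hom =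
      (P.isoExt (R := R) n Y).hom ≫ HomologicalComplex.homologyMap (homCMapY P u) n := by
  have h := congrArg Quiver.Hom.unop (P.leftDerived_app_eq
    (NatTrans.rightOp ((linearYoneda R (ModuleCat.{0} R)).map u)) n)
  exact genY
    (P.isoLeftDerivedObj ((linearYoneda R (ModuleCat.{0} R)).obj Y).rightOp n).inv.unop
    (P.isoLeftDerivedObj ((linearYoneda R (ModuleCat.{0} R)).obj Y').rightOp n).inv.unop
    (P.isoLeftDerivedObj ((linearYoneda R (ModuleCat.{0} R)).obj Y').rightOp n).hom.unop
    _ _ (HomologicalComplex.homologyUnop _ n).inv (HomologicalComplex.homologyUnop _ n).inv _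
    h (by rw [← unop_comp, Iso.inv_hom_id, unop_id]) (homologyUnop_nat' _ n)

lemma isoExt_natX {X X' : ModuleCat.{0} R} (P : ProjectiveResolution X)
    (P' : ProjectiveResolution X')
    (v : X ⟶ X') (φ : P.complex ⟶ P'.complex) (comm : φ.f 0 ≫ P'.π.f 0 = P.π.f 0 ≫ v)
    (Y : ModuleCat.{0} R) (n : ℕ) :
    ((Ext R (ModuleCat.{0} R) n).map v.op).app Y ≫ (P.isoExt (R := R) n Y).hom =
      (P'.isoExt (R := R) n Y).hom ≫ HomologicalComplex.homologyMap (homCMapX P P' φ Y) n := by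
  have h := congrArg Quiver.Hom.unop (ProjectiveResolution.isoLeftDerivedObj_inv_naturality
    v P P' φ comm ((linearYoneda R (ModuleCat.{0} R)).obj Y).rightOp n)
  exact genX
    (P'.isoLeftDerivedObj ((linearYoneda R (ModuleCat.{0} R)).obj Y).rightOp n).inv.unop
    (P.isoLeftDerivedObj ((linearYoneda R (ModuleCat.{0} R)).obj Y).rightOp n).inv.unop
    _ _ (HomologicalComplex.homologyUnop _ n).inv (HomologicalComplex.homologyUnop _ n).inv _
    h (homologyUnop_nat' _ n)

lemma homCMapY_f {X : ModuleCat.{0} R} (P : ProjectiveResolution X) {Y Y' : ModuleCat.{0} R}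
    (u : Y ⟶ Y') (n : ℕ) (f : P.complex.X n ⟶ Y) :
    (homCMapY P u).f n f = (f ≫ u : P.complex.X n ⟶ Y') := rfl

lemma homCMapX_f {X X' : ModuleCat.{0} R} (P : ProjectiveResolution X)
    (P' : ProjectiveResolution X')
    (φ : P.complex ⟶ P'.complex) (Y : ModuleCat.{0} R) (n : ℕ) (f : P'.complex.X n ⟶ Y) :
    (homCMapX P P' φ Y).f n f = (φ.f n ≫ f : P.complex.X n ⟶ Y) := rfl

lemma homC_d {X : ModuleCat.{0} R} (P : ProjectiveResolution X) {Y : ModuleCat.{0} R}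
    (m n : ℕ) (f : P.complex.X m ⟶ Y) :
    (homC P Y).d m n f = (P.complex.d n m ≫ f : P.complex.X n ⟶ Y) := rfl

/-- `f` is a cocycle representing the class `ξ`. -/
def IsCls {X : ModuleCat.{0} R} (P : ProjectiveResolution X) {Y : ModuleCat.{0} R} (n : ℕ)
    (f : P.complex.X n ⟶ Y) (ξ : ((Ext R (ModuleCat.{0} R) n).obj (op X)).obj Y) : Prop :=
  ∃ z : (homC P Y).cycles n, (homC P Y).iCycles n z = f ∧
    (homC P Y).homologyπ n z = (P.isoExt (R := R) n Y).hom ξ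

section
variable {X : ModuleCat.{0} R} (P : ProjectiveResolution X) {Y : ModuleCat.{0} R} (n : ℕ)

lemma isCls_exists (ξ : ((Ext R (ModuleCat.{0} R) n).obj (op X)).obj Y) : ∃ f, IsCls P n f ξ := by
  have : Function.Surjective ((homC P Y).homologyπ n) :=
    (ModuleCat.epi_iff_surjective _).1 inferInstance
  obtain ⟨z, hz⟩ := this ((P.isoExt (R := R) n Y).hom ξ)
  exact ⟨_, z, rfl, hz⟩

variable {P n}

lemma IsCls.cocycle {f : P.complex.X n ⟶ Y} {ξ} (h : IsCls P n f ξ) (m : ℕ) :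
    P.complex.d m n ≫ f = 0 := by
  obtain ⟨z, rfl, -⟩ := h
  have : (homC P Y).d n m ((homC P Y).iCycles n z) = 0 := by
    rw [← ConcreteCategory.comp_apply, HomologicalComplex.iCycles_d]
    rfl
  exact this

variable (P n) in
lemma exists_isCls (f : P.complex.X n ⟶ Y) (hf : P.complex.d (n + 1) n ≫ f = 0) :
    ∃ ξ, IsCls P n f ξ := by
  have hex : ((homC P Y).sc n).moduleCatLeftHomologyData.K =
    ModuleCat.of R (LinearMap.ker ((homC P Y).sc n).g.hom) := rfl
  have hnext : (ComplexShape.up ℕ).next n = n + 1 := by simp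
  have hm : f ∈ LinearMap.ker ((homC P Y).sc n).g.hom := by
    change (homC P Y).d n ((ComplexShape.up ℕ).next n) f = 0
    rw [hnext]
    exact hf
  let z : (homC P Y).cycles n := ((homC P Y).sc n).moduleCatCyclesIso.inv ⟨f, hm⟩
  refine ⟨(P.isoExt (R := R) n Y).inv ((homC P Y).homologyπ n z), z, ?_, ?_⟩
  · change (((homC P Y).sc n).moduleCatCyclesIso.inv ≫ ((homC P Y).sc n).iCycles) _ = _
    rw [ShortComplex.moduleCatCyclesIso_inv_iCycles]
    rfl
  · rw [← ConcreteCategory.comp_apply, Iso.inv_hom_id]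
    rfl

lemma IsCls.zero_iff {f : P.complex.X n ⟶ Y} {ξ} (h : IsCls P n f ξ) {j : ℕ}
    (hj : (ComplexShape.down ℕ).next n = j) :
    ξ = 0 ↔ ∃ g : P.complex.X j ⟶ Y, P.complex.d n j ≫ g = f := by
  obtain ⟨z, rfl, hz⟩ := h
  have hj' : (ComplexShape.up ℕ).prev n = j := hj
  have h1 : ξ = 0 ↔ (homC P Y).homologyπ n z = 0 := by
    rw [hz]
    constructor
    · rintro rfl; simp
    · intro h
      have := congrArg (P.isoExt (R := R) n Y).inv h
      rw [← ConcreteCategory.comp_apply, Iso.hom_inv_id] at this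
      simpa using this
  rw [h1]
  have hex : (ShortComplex.mk ((homC P Y).toCycles j n) ((homC P Y).homologyπ n)
    (by simp)).Exact :=
    ShortComplex.exact_of_g_is_cokernel _ ((homC P Y).homologyIsCokernel j n hj')
  rw [ShortComplex.moduleCat_exact_iff] at hex
  have hinj : Function.Injective ((homC P Y).iCycles n) :=
    (ModuleCat.mono_iff_injective _).1 inferInstance
  have key : ∀ g : (homC P Y).X j, (homC P Y).iCycles n ((homC P Y).toCycles j n g) =
      (homC P Y).d j n g := by
    intro g
    rw [← ConcreteCategory.comp_apply, (homC P Y).toCycles_i]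
  constructor
  · intro h
    obtain ⟨g, hg⟩ := hex z h
    refine ⟨g, ?_⟩
    exact (key g).symm.trans (congrArg ((homC P Y).iCycles n) hg)
  · rintro ⟨g, hg⟩
    have : (homC P Y).toCycles j n g = z := hinj ((key g).trans hg)
    have h0 : ∀ g : (homC P Y).X j, (homC P Y).homologyπ n ((homC P Y).toCycles j n g) = 0 := by
      intro g
      rw [← ConcreteCategory.comp_apply, (homC P Y).toCycles_comp_homologyπ]
      rfl
    exact (congrArg _ this.symm).trans (h0 g)

lemma IsCls.add {f g : P.complex.X n ⟶ Y} {ξ η} (h : IsCls P n f ξ) (h' : IsCls P n g η) :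
    IsCls P n (f + g) (ξ + η) := by
  obtain ⟨z, rfl, hz⟩ := h
  obtain ⟨z', rfl, hz'⟩ := h'
  exact ⟨z + z', map_add _ _ _, by rw [map_add, map_add, hz, hz']⟩

lemma IsCls.smul {f : P.complex.X n ⟶ Y} {ξ} (r : R) (h : IsCls P n f ξ) :
    IsCls P n (r • f) (r • ξ) := by
  obtain ⟨z, rfl, hz⟩ := h
  exact ⟨r • z, map_smul ((homC P Y).iCycles n).hom _ _,
    by rw [map_smul ((homC P Y).homologyπ n).hom, map_smul (P.isoExt (R := R) n Y).hom.hom, hz]⟩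

lemma IsCls.mapY {Y' : ModuleCat.{0} R} {f : P.complex.X n ⟶ Y} {ξ} (h : IsCls P n f ξ)
    (u : Y ⟶ Y') :
    IsCls P n (f ≫ u) (((Ext R (ModuleCat.{0} R) n).obj (op X)).map u ξ) := by
  obtain ⟨z, rfl, hz⟩ := h
  refine ⟨HomologicalComplex.cyclesMap (homCMapY P u) n z, ?_, ?_⟩
  · have h1 := congrArg (fun q => q.hom z) (HomologicalComplex.cyclesMap_i (homCMapY P u) n)
    exact h1
  · have h1 := congrArg (fun q => q.hom z)
      (HomologicalComplex.homologyπ_naturality (homCMapY P u) n)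
    have h2 := congrArg (fun q => q.hom ξ) (isoExt_natY P u n)
    have h3 := congrArg (fun x => HomologicalComplex.homologyMap (homCMapY P u) n x) hz
    exact h1.symm.trans (h3.trans h2.symm)

lemma IsCls.mapX {X' : ModuleCat.{0} R} {P' : ProjectiveResolution X'}
    {f : P.complex.X n ⟶ Y} {ξ} (h : IsCls P n f ξ)
    (v : X' ⟶ X) (φ : P'.complex ⟶ P.complex) (comm : φ.f 0 ≫ P.π.f 0 = P'.π.f 0 ≫ v) :
    IsCls P' n (φ.f n ≫ f) (((Ext R (ModuleCat.{0} R) n).map v.op).app Y ξ) := by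
  obtain ⟨z, rfl, hz⟩ := h
  refine ⟨HomologicalComplex.cyclesMap (homCMapX P' P φ Y) n z, ?_, ?_⟩
  · have h1 := congrArg (fun q => q.hom z) (HomologicalComplex.cyclesMap_i (homCMapX P' P φ Y) n)
    exact h1
  · have h1 := congrArg (fun q => q.hom z)
      (HomologicalComplex.homologyπ_naturality (homCMapX P' P φ Y) n)
    have h2 := congrArg (fun q => q.hom ξ) (isoExt_natX _ _ v φ comm Y n)
    have h3 := congrArg (fun x => HomologicalComplex.homologyMap (homCMapX P' P φ Y) n x) hz
    exact h1.symm.trans (h3.trans h2.symm)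

lemma IsCls.uniq {f : P.complex.X n ⟶ Y} {ξ η} (h : IsCls P n f ξ) (h' : IsCls P n f η) :
    ξ = η := by
  have := h.add (h'.smul (-1))
  have h2 := (this.zero_iff rfl).2 ⟨0, by simp⟩
  simpa [← sub_eq_add_neg, sub_eq_zero] using h2

end

/-- the object `R / a^m` -/
abbrev Rm (a : Ideal R) (m : ℕ) : ModuleCat.{0} R := ModuleCat.of R (R ⧸ a ^ m)

/-- the chosen resolution -/
abbrev Pm (a : Ideal R) (m : ℕ) : ProjectiveResolution (Rm a m) := projectiveResolution _

/-- transition map -/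
def vm (a : Ideal R) {m k : ℕ} (h : m ≤ k) : Rm a k ⟶ Rm a m :=
  ModuleCat.ofHom (Submodule.mapQ _ _ LinearMap.id (Ideal.pow_le_pow_right h))

/-- lift of the transition map -/
def phi (a : Ideal R) {m k : ℕ} (h : m ≤ k) : (Pm a k).complex ⟶ (Pm a m).complex :=
  ProjectiveResolution.lift (vm a h) _ _

lemma phi_comm (a : Ideal R) {m k : ℕ} (h : m ≤ k) :
    (phi a h).f 0 ≫ (Pm a m).π.f 0 = (Pm a k).π.f 0 ≫ vm a h :=
  ProjectiveResolution.lift_commutes_zero (vm a h) _ _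

/-- the `i`-th local cohomology -/
abbrev H (a : Ideal R) (i : ℕ) (M : ModuleCat.{0} R) : ModuleCat.{0} R :=
  (localCohomology a i).obj M

/-- the `i`-th local cohomology on maps -/
abbrev Hmap (a : Ideal R) (i : ℕ) {M N : ModuleCat.{0} R} (u : M ⟶ N) : H a i M ⟶ H a i N :=
  (localCohomology a i).map u

/-- structure map to the colimit -/
def iota (a : Ideal R) (i m : ℕ) (M : ModuleCat.{0} R) :
    ((Ext R (ModuleCat.{0} R) i).obj (op (Rm a m))).obj M ⟶ H a i M :=
  (colimit.ι (localCohomology.diagram (localCohomology.idealPowersDiagram a) i) (op (op m))).app M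

lemma iota_nat (a : Ideal R) (i m : ℕ) {M N : ModuleCat.{0} R} (u : M ⟶ N) :
    ((Ext R (ModuleCat.{0} R) i).obj (op (Rm a m))).map u ≫ iota a i m N =
      iota a i m M ≫ Hmap a i u :=
  (colimit.ι (localCohomology.diagram (localCohomology.idealPowersDiagram a) i)
    (op (op m))).naturality u

lemma iota_w (a : Ideal R) (i : ℕ) {m k : ℕ} (h : m ≤ k) (M : ModuleCat.{0} R) :
    ((Ext R (ModuleCat.{0} R) i).map (vm a h).op).app M ≫ iota a i k M = iota a i m M := by
  have := congrArg (fun t => NatTrans.app t M)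
    (colimit.w (localCohomology.diagram (localCohomology.idealPowersDiagram a) i)
      (j := op (op k)) (j' := op (op m)) (homOfLE h).op.op)
  exact this

/-- the evaluated diagram -/
abbrev dg (a : Ideal R) (i : ℕ) (M : ModuleCat.{0} R) : ℕᵒᵖᵒᵖ ⥤ ModuleCat.{0} R :=
  localCohomology.diagram (localCohomology.idealPowersDiagram a) i ⋙
    (evaluation _ _).obj M

/-- evaluated colimit cocone -/
def dgColim (a : Ideal R) (i : ℕ) (M : ModuleCat.{0} R) :=
  isColimitOfPreserves ((evaluation (ModuleCat.{0} R) (ModuleCat.{0} R)).obj M)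
    (colimit.isColimit (localCohomology.diagram (localCohomology.idealPowersDiagram a) i))

lemma iota_exists (a : Ideal R) (i : ℕ) (M : ModuleCat.{0} R) (ξ : H a i M) :
    ∃ m e, iota a i m M e = ξ := by
  obtain ⟨j, y, hy⟩ := Concrete.isColimit_exists_rep (dg a i M) (dgColim a i M) ξ
  exact ⟨j.unop.unop, y, hy⟩

lemma iota_zero (a : Ideal R) (i m : ℕ) (M : ModuleCat.{0} R) (e)
    (h : iota a i m M e = 0) : ∃ k, ∃ h : m ≤ k,
      ((Ext R (ModuleCat.{0} R) i).map (vm a h).op).app M e = 0 := by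
  have h0 : iota a i m M 0 = 0 := map_zero (iota a i m M).hom
  obtain ⟨j, f, hf⟩ := ((dgColim a i M).eq_iff' (F := dg a i M) (i := op (op m)) e 0).1
    (h.trans h0.symm)
  refine ⟨j.unop.unop, leOfHom f.unop.unop, ?_⟩
  refine hf.trans ?_
  exact map_zero ((dg a i M).map f).hom

/-- cocycle `f` at stage `m` represents `ξ` -/
def Rep (a : Ideal R) (i m : ℕ) {M : ModuleCat.{0} R} (f : (Pm a m).complex.X i ⟶ M)
    (ξ : H a i M) : Prop :=
  ∃ e, IsCls (Pm a m) i f e ∧ iota a i m M e = ξ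

section
variable {a : Ideal R} {i m : ℕ} {M N : ModuleCat.{0} R}

lemma rep_exists (ξ : H a i M) : ∃ m f, Rep a i m f ξ := by
  obtain ⟨m, e, he⟩ := iota_exists a i M ξ
  obtain ⟨f, hf⟩ := isCls_exists (Pm a m) i e
  exact ⟨m, f, e, hf, he⟩

lemma exists_rep (f : (Pm a m).complex.X i ⟶ M) (hf : (Pm a m).complex.d (i + 1) i ≫ f = 0) :
    ∃ ξ, Rep a i m f ξ := by
  obtain ⟨e, he⟩ := exists_isCls (Pm a m) i f hf
  exact ⟨_, e, he, rfl⟩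

lemma Rep.cocycle {f : (Pm a m).complex.X i ⟶ M} {ξ} (h : Rep a i m f ξ) (k : ℕ) :
    (Pm a m).complex.d k i ≫ f = 0 := by
  obtain ⟨e, h, -⟩ := h
  exact h.cocycle k

lemma Rep.add {f g : (Pm a m).complex.X i ⟶ M} {ξ η} (h : Rep a i m f ξ) (h' : Rep a i m g η) :
    Rep a i m (f + g) (ξ + η) := by
  obtain ⟨e, h, rfl⟩ := h
  obtain ⟨e', h', rfl⟩ := h'
  exact ⟨_, h.add h', map_add _ _ _⟩

lemma Rep.smul {f : (Pm a m).complex.X i ⟶ M} {ξ} (r : R) (h : Rep a i m f ξ) :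
    Rep a i m (r • f) (r • ξ) := by
  obtain ⟨e, h, rfl⟩ := h
  exact ⟨_, h.smul r, map_smul (iota a i m M).hom _ _⟩

lemma Rep.sub {f g : (Pm a m).complex.X i ⟶ M} {ξ η} (h : Rep a i m f ξ) (h' : Rep a i m g η) :
    Rep a i m (f - g) (ξ - η) := by
  simpa [sub_eq_add_neg] using h.add (h'.smul (-1))

lemma Rep.map {f : (Pm a m).complex.X i ⟶ M} {ξ} (h : Rep a i m f ξ) (u : M ⟶ N) :
    Rep a i m (f ≫ u) (Hmap a i u ξ) := by
  obtain ⟨e, h, rfl⟩ := h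
  refine ⟨_, h.mapY u, ?_⟩
  exact congrArg (fun q => q.hom e) (iota_nat a i m u)

lemma Rep.up {f : (Pm a m).complex.X i ⟶ M} {ξ} (h : Rep a i m f ξ) {k : ℕ} (hk : m ≤ k) :
    Rep a i k ((phi a hk).f i ≫ f) ξ := by
  obtain ⟨e, h, rfl⟩ := h
  refine ⟨_, h.mapX (vm a hk) (phi a hk) (phi_comm a hk), ?_⟩
  exact congrArg (fun q => q.hom e) (iota_w a i hk M)

lemma Rep.uniq {f : (Pm a m).complex.X i ⟶ M} {ξ η} (h : Rep a i m f ξ) (h' : Rep a i m f η) :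
    ξ = η := by
  obtain ⟨e, h, rfl⟩ := h
  obtain ⟨e', h', rfl⟩ := h'
  rw [h.uniq h']

lemma Rep.eq_zero {f : (Pm a m).complex.X i ⟶ M} {ξ} (h : Rep a i m f ξ) {j : ℕ}
    (hj : (ComplexShape.down ℕ).next i = j) (g : (Pm a m).complex.X j ⟶ M)
    (hg : (Pm a m).complex.d i j ≫ g = f) : ξ = 0 := by
  obtain ⟨e, h, rfl⟩ := h
  rw [(h.zero_iff hj).2 ⟨g, hg⟩]
  exact map_zero (iota a i m M).hom

lemma Rep.exists_of_zero {f : (Pm a m).complex.X i ⟶ M} (h : Rep a i m f 0) {j : ℕ}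
    (hj : (ComplexShape.down ℕ).next i = j) : ∃ k, ∃ hk : m ≤ k,
      ∃ g : (Pm a k).complex.X j ⟶ M, (Pm a k).complex.d i j ≫ g = (phi a hk).f i ≫ f := by
  obtain ⟨e, h, he⟩ := h
  obtain ⟨k, hk, h0⟩ := iota_zero a i m M e he
  exact ⟨k, hk, ((h.mapX (vm a hk) (phi a hk) (phi_comm a hk)).zero_iff hj).1 h0⟩

lemma gen_smul {A X : ModuleCat.{0} R} (e : A ⟶ X) (r : R) : (r • 𝟙 A) ≫ e = e ≫ (r • 𝟙 X) := by
  simp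

lemma gen_zero {A X : ModuleCat.{0} R} (e : A ⟶ X) : (0 : A ⟶ A) ≫ e = e ≫ (0 : X ⟶ X) := by
  simp

/-- every element is killed by a power of `a` -/
lemma Rep.torsion {f : (Pm a m).complex.X i ⟶ M} {ξ} (h : Rep a i m f ξ) (r : R)
    (hr : r ∈ a ^ m) : r • ξ = 0 := by
  obtain ⟨e, h, rfl⟩ := h
  have hv : r • 𝟙 (Rm a m) = 0 := by
    refine ModuleCat.hom_ext (LinearMap.ext fun x => ?_)
    obtain ⟨y, rfl⟩ := Ideal.Quotient.mk_surjective x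
    change r • (Ideal.Quotient.mk (a ^ m) y) = 0
    rw [Algebra.smul_def]
    change Ideal.Quotient.mk (a ^ m) r * _ = 0
    rw [Ideal.Quotient.eq_zero_iff_mem.2 hr, zero_mul]
  have h1 := h.mapX (P' := Pm a m) (r • 𝟙 (Rm a m)) (r • 𝟙 _) (gen_smul _ r)
  have h2 := h.mapX (P' := Pm a m) (r • 𝟙 (Rm a m)) 0 (by rw [hv]; exact gen_zero _)
  have h4 := h.smul r
  simp only [HomologicalComplex.smul_f_apply, HomologicalComplex.id_f, Linear.smul_comp,
    Category.id_comp] at h1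
  have h6 := h1.uniq h4
  have h7 := (h2.zero_iff rfl).2 ⟨0, by simp⟩
  rw [← map_smul (iota a i m M).hom, ← h6, h7]
  exact map_zero (iota a i m M).hom

lemma Hmap_smul (r : R) (ξ : H a i M) : Hmap a i (r • 𝟙 M) ξ = r • ξ := by
  obtain ⟨m, f, hf⟩ := rep_exists ξ
  have := hf.map (r • 𝟙 M)
  simp only [Linear.comp_smul, Category.comp_id] at this
  exact this.uniq (hf.smul r)

lemma Hmap_add (u v : M ⟶ N) (ξ : H a i M) : Hmap a i (u + v) ξ = Hmap a i u ξ + Hmap a i v ξ := by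
  obtain ⟨m, f, hf⟩ := rep_exists ξ
  have := hf.map (u + v)
  rw [Preadditive.comp_add] at this
  exact this.uniq ((hf.map u).add (hf.map v))

instance : (localCohomology a i).Additive where
  map_add {_ _ u v} := by
    ext ξ
    exact Hmap_add u v ξ

end

/-- short exact sequences, elementwise -/
structure SES {A B C : ModuleCat.{0} R} (j : A ⟶ B) (q : B ⟶ C) : Prop where
  inj : Function.Injective j
  zero : j ≫ q = 0
  ex : ∀ b, q b = 0 → ∃ x, j x = b
  surj : Function.Surjective q

section
variable {A B C : ModuleCat.{0} R} {j : A ⟶ B} {q : B ⟶ C}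

lemma SES.factor (S : SES j q) {P : ModuleCat.{0} R} (g : P ⟶ B) (h : g ≫ q = 0) :
    ∃ k : P ⟶ A, k ≫ j = g := by
  have hr : ∀ x, g.hom x ∈ LinearMap.range j.hom := by
    intro x
    obtain ⟨y, hy⟩ := S.ex (g x) (congrArg (fun t => t.hom x) h)
    exact ⟨y, hy⟩
  refine ⟨ModuleCat.ofHom ((LinearEquiv.ofInjective j.hom S.inj).symm.toLinearMap ∘ₗ
    g.hom.codRestrict _ hr), ?_⟩
  refine ModuleCat.hom_ext (LinearMap.ext fun x => ?_)
  have := congrArg Subtype.val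
    ((LinearEquiv.ofInjective j.hom S.inj).apply_symm_apply (g.hom.codRestrict _ hr x))
  exact this

lemma SES.lift (S : SES j q) {P : ModuleCat.{0} R} [Projective P] (g : P ⟶ C) :
    ∃ k : P ⟶ B, k ≫ q = g := by
  have : Epi q := (ModuleCat.epi_iff_surjective _).2 S.surj
  exact ⟨Projective.factorThru g q, Projective.factorThru_comp _ _⟩

lemma SES.cancel (S : SES j q) {P : ModuleCat.{0} R} (g h : P ⟶ A) (e : g ≫ j = h ≫ j) :
    g = h := by
  have : Mono j := (ModuleCat.mono_iff_injective _).2 S.inj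
  exact (cancel_mono j).1 e

variable {a : Ideal R} {i : ℕ}

lemma phi_d {m k : ℕ} (hk : m ≤ k) (i j : ℕ) :
    (phi a hk).f i ≫ (Pm a m).complex.d i j = (Pm a k).complex.d i j ≫ (phi a hk).f j :=
  (phi a hk).comm i j

lemma SES.mid (S : SES j q) (ξ : H a i B) (h : Hmap a i q ξ = 0) : ∃ ζ, Hmap a i j ζ = ξ := by
  obtain ⟨m, f, hf⟩ := rep_exists ξ
  have h0 := hf.map q
  rw [h] at h0
  obtain ⟨k, hk, g, hg⟩ := h0.exists_of_zero rfl
  obtain ⟨g', rfl⟩ := S.lift g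
  obtain ⟨t, ht⟩ := S.factor ((phi a hk).f i ≫ f - (Pm a k).complex.d i _ ≫ g') (by
    rw [Preadditive.sub_comp, Category.assoc, Category.assoc, hg, sub_self])
  have hc : (Pm a k).complex.d (i + 1) i ≫ t = 0 := by
    apply S.cancel
    rw [Category.assoc, ht, Preadditive.comp_sub, (hf.up hk).cocycle, ← Category.assoc,
      HomologicalComplex.d_comp_d, zero_comp, zero_comp, sub_zero]
  obtain ⟨ζ, hζ⟩ := exists_rep t hc
  refine ⟨ζ, ?_⟩
  have := (hf.up hk).sub (hζ.map j)
  rw [ht, sub_sub_cancel] at this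
  exact (sub_eq_zero.1 (this.eq_zero rfl _ rfl)).symm

lemma SES.surjH (S : SES j q) (hA : Subsingleton (H a (i + 1) A)) (η : H a i C) :
    ∃ ξ, Hmap a i q ξ = η := by
  obtain ⟨m, f, hf⟩ := rep_exists η
  obtain ⟨g, rfl⟩ := S.lift f
  obtain ⟨t, ht⟩ := S.factor ((Pm a m).complex.d (i + 1) i ≫ g) (by
    rw [Category.assoc, hf.cocycle])
  obtain ⟨ζ, hζ⟩ := exists_rep t (S.cancel _ _ (by
    rw [Category.assoc, ht, ← Category.assoc, HomologicalComplex.d_comp_d, zero_comp, zero_comp]))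
  rw [Subsingleton.elim ζ 0] at hζ
  obtain ⟨k, hk, h, hh⟩ := hζ.exists_of_zero (j := i) (by simp)
  obtain ⟨ξ, hξ⟩ := exists_rep ((phi a hk).f i ≫ g - h ≫ j) (by
    rw [Preadditive.comp_sub, ← Category.assoc, ← phi_d, Category.assoc, ← ht, ← Category.assoc,
      ← hh, Category.assoc, sub_self])
  refine ⟨ξ, ?_⟩
  have h2 := hξ.map q
  rw [Preadditive.sub_comp, Category.assoc, Category.assoc, S.zero, comp_zero, sub_zero] at h2
  exact h2.uniq (hf.up hk)

lemma SES.kill (S : SES j q) (s : R) (hs : ∀ η : H a i C, ∃ β, Hmap a i q β = s • η)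
    (ξ : H a (i + 1) A) (hξ : Hmap a (i + 1) j ξ = 0) : s • ξ = 0 := by
  obtain ⟨m, f, hf⟩ := rep_exists ξ
  have h0 := hf.map j
  rw [hξ] at h0
  obtain ⟨k, hk, g, hg⟩ := h0.exists_of_zero (j := i) (by simp)
  replace hf := hf.up hk
  rw [← Category.assoc] at hg
  generalize (phi a hk).f (i + 1) ≫ f = f' at hf hg
  clear h0 hk f m
  obtain ⟨η, hη⟩ := exists_rep (g ≫ q) (by
    rw [← Category.assoc, hg, Category.assoc, S.zero, comp_zero])
  obtain ⟨β, hβ⟩ := hs η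
  obtain ⟨n, b, hb⟩ := rep_exists β
  have hkl : k ≤ max k n := le_max_left _ _
  have hnl : n ≤ max k n := le_max_right _ _
  have h1 := ((hη.up hkl).smul s).sub ((hb.up hnl).map q)
  rw [hβ, sub_self] at h1
  obtain ⟨l, hl, c, hc⟩ := h1.exists_of_zero rfl
  obtain ⟨c', rfl⟩ := S.lift c
  obtain ⟨t, ht⟩ := S.factor ((phi a hl).f i ≫ (s • (phi a hkl).f i ≫ g -
      (phi a hnl).f i ≫ b) - (Pm a l).complex.d i _ ≫ c') (by
    rw [Preadditive.sub_comp, Category.assoc, Category.assoc, hc]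
    simp only [Preadditive.sub_comp, Preadditive.comp_sub, Linear.smul_comp, Linear.comp_smul,
      Category.assoc, sub_self])
  refine (((hf.up hkl).up hl).smul s).eq_zero (j := i) (by simp) t (S.cancel _ _ ?_)
  have e1 : (Pm a l).complex.d (i + 1) i ≫ (phi a hl).f i ≫ (phi a hnl).f i ≫ b = 0 :=
    ((hb.up hnl).up hl).cocycle _
  have e2 : (Pm a l).complex.d (i + 1) i ≫ (phi a hl).f i ≫ (phi a hkl).f i ≫ g =
      (phi a hl).f (i + 1) ≫ (phi a hkl).f (i + 1) ≫ f' ≫ j := by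
    rw [← hg, ← Category.assoc ((phi a hkl).f (i + 1)), phi_d, Category.assoc,
      ← Category.assoc ((phi a hl).f (i + 1)), phi_d, Category.assoc]
  rw [Category.assoc, ht]
  simp only [Preadditive.comp_sub, Linear.smul_comp, Linear.comp_smul,
      Category.assoc, e1, e2, sub_zero]
  rw [← Category.assoc ((Pm a l).complex.d (i + 1) i), HomologicalComplex.d_comp_d, zero_comp,
    sub_zero]

end

section
variable {a : Ideal R} {i : ℕ}

lemma H_injective (M : ModuleCat.{0} R) [Injective M] : Subsingleton (H a (i + 1) M) := by
  refine subsingleton_of_forall_eq 0 fun ξ => ?_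
  obtain ⟨m, f, hf⟩ := rep_exists ξ
  have hex := (Pm a m).exact_succ i
  exact hf.eq_zero (j := i) (by simp) (hex.descToInjective f (hf.cocycle _))
    (hex.comp_descToInjective _ _)

/-- augmentation -/
def aug (a : Ideal R) (m : ℕ) : (Pm a m).complex.X 0 ⟶ Rm a m := (Pm a m).π.f 0

lemma rep_zero {M : ModuleCat.{0} R} {m : ℕ} {f : (Pm a m).complex.X 0 ⟶ M} {ξ}
    (h : Rep a 0 m f ξ) : ∃ u : Rm a m ⟶ M, aug a m ≫ u = f := by
  have hex := (Pm a m).exact₀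
  have : Epi (ShortComplex.mk _ _ (Pm a m).complex_d_comp_π_f_zero).g := by
    exact inferInstanceAs (Epi ((Pm a m).π.f 0))
  exact ⟨hex.desc f (h.cocycle _), hex.g_desc _ _⟩

lemma rep_aug {M : ModuleCat.{0} R} {m : ℕ} (u : Rm a m ⟶ M) :
    ∃ ξ, Rep a 0 m (aug a m ≫ u) ξ := by
  refine exists_rep _ ?_
  rw [← Category.assoc]
  have : (Pm a m).complex.d (0 + 1) 0 ≫ aug a m = 0 := (Pm a m).complex_d_comp_π_f_zero
  rw [this, zero_comp]

lemma Rm_smul {m : ℕ} (r x : R) :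
    (Ideal.Quotient.mk (a ^ m) (r * x) : Rm a m) = r • (Ideal.Quotient.mk (a ^ m) x : Rm a m) := rfl

lemma Rm_hom_apply {M : ModuleCat.{0} R} {m : ℕ} (u : Rm a m ⟶ M) (r : R) :
    u (Ideal.Quotient.mk (a ^ m) r : Rm a m) = r • u (Ideal.Quotient.mk (a ^ m) 1 : Rm a m) := by
  have : (Ideal.Quotient.mk (a ^ m) r : Rm a m) = r • (Ideal.Quotient.mk (a ^ m) 1 : Rm a m) := by
    rw [← Rm_smul, mul_one]
  rw [this]
  exact map_smul u.hom _ _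

lemma Rm_hom_tors {M : ModuleCat.{0} R} {m : ℕ} (u : Rm a m ⟶ M) (r : R) (hr : r ∈ a ^ m) :
    r • u (Ideal.Quotient.mk (a ^ m) 1 : Rm a m) = 0 := by
  rw [← Rm_hom_apply, Ideal.Quotient.eq_zero_iff_mem.2 hr]
  exact map_zero u.hom

lemma Rm_hom_ext {M : ModuleCat.{0} R} {m : ℕ} (u v : Rm a m ⟶ M)
    (h : u (Ideal.Quotient.mk (a ^ m) 1 : Rm a m) = v (Ideal.Quotient.mk (a ^ m) 1 : Rm a m)) :
    u = v := by
  refine ModuleCat.hom_ext (LinearMap.ext fun x => ?_)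
  obtain ⟨y, rfl⟩ := Ideal.Quotient.mk_surjective x
  have h1 := Rm_hom_apply u y
  have h2 := Rm_hom_apply v y
  rw [h] at h1
  exact h1.trans h2.symm

lemma Rm_hom_exists {M : ModuleCat.{0} R} {m : ℕ} (x : M) (hx : ∀ r ∈ a ^ m, r • x = 0) :
    ∃ u : Rm a m ⟶ M, u (Ideal.Quotient.mk (a ^ m) 1 : Rm a m) = x := by
  refine ⟨ModuleCat.ofHom (Submodule.liftQ (a ^ m) (LinearMap.toSpanSingleton R M x)
    (fun r hr => hx r hr)), ?_⟩
  exact one_smul R x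

/-- torsion modules -/
def Tors (a : Ideal R) (M : Type) [AddCommGroup M] [Module R M] : Prop :=
  ∀ x : M, ∃ n : ℕ, ∀ r ∈ a ^ n, r • x = 0

lemma H0_surj {M N : ModuleCat.{0} R} (q : M ⟶ N) (hq : Function.Surjective q)
    (hM : Tors a M) (η : H a 0 N) : ∃ ξ, Hmap a 0 q ξ = η := by
  obtain ⟨m, f, hf⟩ := rep_exists η
  obtain ⟨u, rfl⟩ := rep_zero hf
  obtain ⟨x, hx⟩ := hq (u (Ideal.Quotient.mk (a ^ m) 1 : Rm a m))
  obtain ⟨n, hn⟩ := hM x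
  have hml : m ≤ max m n := le_max_left _ _
  obtain ⟨u2, hu2⟩ := Rm_hom_exists (a := a) (m := max m n) x
    (fun r hr => hn r (Ideal.pow_le_pow_right (le_max_right _ _) hr))
  obtain ⟨ξ, hξ⟩ := rep_aug u2
  refine ⟨ξ, (hξ.map q).uniq ?_⟩
  have h1 := hf.up hml
  have h2 : (phi a hml).f 0 ≫ aug a m = aug a _ ≫ vm a hml := phi_comm a hml
  rw [← Category.assoc, h2] at h1
  rw [Category.assoc] at h1 ⊢
  have : u2 ≫ q = vm a hml ≫ u := by
    apply Rm_hom_ext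
    exact (congrArg q hu2).trans hx
  rw [this]
  exact h1

lemma H0_kill {M : ModuleCat.{0} R} (s : R)
    (hs : ∀ x : M, ∀ n : ℕ, (∀ r ∈ a ^ n, r • x = 0) → s • x = 0) (ξ : H a 0 M) : s • ξ = 0 := by
  obtain ⟨m, f, hf⟩ := rep_exists ξ
  obtain ⟨u, rfl⟩ := rep_zero hf
  have h1 := hf.smul s
  have : s • u = 0 := by
    apply Rm_hom_ext
    exact hs _ m (fun r hr => Rm_hom_tors u r hr)
  rw [← Linear.comp_smul, this] at h1
  exact h1.eq_zero rfl 0 (by simp)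

end

/-- the `a`-power torsion submodule -/
def Gam (a : Ideal R) (E : Type) [AddCommGroup E] [Module R E] : Submodule R E where
  carrier := {x | ∃ n : ℕ, ∀ r ∈ a ^ n, r • x = 0}
  zero_mem' := ⟨0, fun r _ => smul_zero r⟩
  add_mem' := by
    rintro x y ⟨n, hn⟩ ⟨m, hm⟩
    refine ⟨max n m, fun r hr => ?_⟩
    rw [smul_add, hn r (Ideal.pow_le_pow_right (le_max_left _ _) hr),
      hm r (Ideal.pow_le_pow_right (le_max_right _ _) hr), add_zero]
  smul_mem' := by
    rintro c x ⟨n, hn⟩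
    refine ⟨n, fun r hr => ?_⟩
    rw [smul_comm, hn r hr, smul_zero]

lemma mem_Gam {a : Ideal R} {E : Type} [AddCommGroup E] [Module R E] {x : E} :
    x ∈ Gam a E ↔ ∃ n : ℕ, ∀ r ∈ a ^ n, r • x = 0 := Iff.rfl

lemma fg_unif (a : Ideal R) {E : Type} [AddCommGroup E] [Module R E] (N : Submodule R E)
    (hN : N.FG) (h : N ≤ Gam a E) : ∃ n : ℕ, ∀ r ∈ a ^ n, ∀ x ∈ N, r • x = 0 := by
  induction N, hN using Submodule.fg_induction with
  | singleton x =>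
    obtain ⟨n, hn⟩ := h (Submodule.mem_span_singleton_self x)
    refine ⟨n, fun r hr y hy => ?_⟩
    obtain ⟨c, rfl⟩ := Submodule.mem_span_singleton.1 hy
    rw [smul_comm, hn r hr, smul_zero]
  | sup N₁ N₂ _ _ h₁ h₂ =>
    obtain ⟨n, hn⟩ := h₁ (le_sup_left.trans h)
    obtain ⟨m, hm⟩ := h₂ (le_sup_right.trans h)
    refine ⟨max n m, fun r hr y hy => ?_⟩
    obtain ⟨u, hu, v, hv, rfl⟩ := Submodule.mem_sup.1 hy
    rw [smul_add, hn r (Ideal.pow_le_pow_right (le_max_left _ _) hr) u hu,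
      hm r (Ideal.pow_le_pow_right (le_max_right _ _) hr) v hv, add_zero]

lemma Gam_baer [IsNoetherianRing R] (a : Ideal R) (E : Type) [AddCommGroup E] [Module R E]
    [hE : Module.Injective R E] : Module.Baer R (Gam a E) := by
  intro I g
  let g₁ : I →ₗ[R] E := (Gam a E).subtype ∘ₗ g
  obtain ⟨n, hn⟩ := fg_unif a (LinearMap.range g₁) (by
      rw [← Submodule.map_top]
      exact (IsNoetherian.noetherian (⊤ : Submodule R I)).map g₁) (by
    rintro _ ⟨x, rfl⟩
    exact (g x).2)
  obtain ⟨k, hk⟩ := a.exists_pow_inf_eq_pow_smul (I : Submodule R R)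
  have hN : ∀ x : I, (x : R) ∈ a ^ (n + k) → g₁ x = 0 := by
    intro x hx
    have h1 : (x : R) ∈ a ^ n • (I : Submodule R R) := by
      have h2 : (x : R) ∈ (a ^ (n + k) • ⊤ ⊓ I : Submodule R R) := ⟨by simpa using hx, x.2⟩
      rw [hk (n + k) (Nat.le_add_left _ _), Nat.add_sub_cancel] at h2
      exact Submodule.smul_mono le_rfl inf_le_right h2
    have h3 : ∀ y ∈ a ^ n • (I : Submodule R R), ∃ hy : y ∈ I, g₁ ⟨y, hy⟩ = 0 := by
      intro y hy
      induction hy using Submodule.smul_induction_on' with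
      | smul r hr z hz =>
        refine ⟨I.smul_mem r hz, ?_⟩
        have : (⟨r • z, I.smul_mem r hz⟩ : I) = r • ⟨z, hz⟩ := rfl
        rw [this, map_smul]
        exact hn r hr _ ⟨_, rfl⟩
      | add u hu v hv h1 h2 =>
        obtain ⟨p1, e1⟩ := h1
        obtain ⟨p2, e2⟩ := h2
        refine ⟨I.add_mem p1 p2, ?_⟩
        have : (⟨u + v, I.add_mem p1 p2⟩ : I) = ⟨u, p1⟩ + ⟨v, p2⟩ := rfl
        rw [this, map_add, e1, e2, add_zero]
    exact (h3 _ h1).2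
  let π : R →ₗ[R] R ⧸ a ^ (n + k) := Submodule.mkQ _
  let c : I →ₗ[R] R ⧸ a ^ (n + k) := π ∘ₗ Submodule.subtype I
  let f : (I ⧸ LinearMap.ker c) →ₗ[R] R ⧸ a ^ (n + k) := (LinearMap.ker c).liftQ c le_rfl
  have hf : Function.Injective f := by
    rw [← LinearMap.ker_eq_bot]
    exact Submodule.ker_liftQ_eq_bot _ _ _ le_rfl
  let g₂ : (I ⧸ LinearMap.ker c) →ₗ[R] E := (LinearMap.ker c).liftQ g₁ (by
    intro x hx
    refine hN x ?_
    exact (Submodule.Quotient.mk_eq_zero _).1 hx)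
  obtain ⟨h, hh⟩ := hE.out f hf g₂
  have hG : ∀ x, (h ∘ₗ π) x ∈ Gam a E := by
    intro x
    refine ⟨n + k, fun r hr => ?_⟩
    rw [← map_smul]
    have : π (r • x) = 0 := (Submodule.Quotient.mk_eq_zero _).2 (Ideal.mul_mem_right _ _ hr)
    rw [LinearMap.comp_apply, this, map_zero]
  refine ⟨(h ∘ₗ π).codRestrict _ hG, fun x hx => Subtype.ext ?_⟩
  exact hh (Submodule.Quotient.mk ⟨x, hx⟩)

lemma SES_coker {A B : Type} [AddCommGroup A] [Module R A] [AddCommGroup B] [Module R B]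
    (f : A →ₗ[R] B) (hf : Function.Injective f) :
    SES (ModuleCat.ofHom f) (ModuleCat.ofHom (LinearMap.range f).mkQ) where
  inj := hf
  zero := ModuleCat.hom_ext (LinearMap.range_mkQ_comp f)
  ex _ hb := (Submodule.Quotient.mk_eq_zero _).1 hb
  surj := Submodule.mkQ_surjective _

lemma SES_ker {B C : Type} [AddCommGroup B] [Module R B] [AddCommGroup C] [Module R C]
    (f : B →ₗ[R] C) (hf : Function.Surjective f) :
    SES (ModuleCat.ofHom (LinearMap.ker f).subtype) (ModuleCat.ofHom f) where
  inj := Subtype.val_injective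
  zero := ModuleCat.hom_ext (LinearMap.ext fun x => x.2)
  ex b hb := ⟨⟨b, hb⟩, rfl⟩
  surj := hf

lemma SES_ideal (J : Ideal R) :
    SES (ModuleCat.ofHom (Submodule.subtype J)) (ModuleCat.ofHom (Submodule.mkQ J)) where
  inj := Subtype.val_injective
  zero := ModuleCat.hom_ext (LinearMap.ext fun x => (Submodule.Quotient.mk_eq_zero _).2 x.2)
  ex b hb := ⟨⟨b, (Submodule.Quotient.mk_eq_zero _).1 hb⟩, rfl⟩
  surj := Submodule.mkQ_surjective _

lemma SES.left_zero {A B C : ModuleCat.{0} R} {j : A ⟶ B} {q : B ⟶ C} (S : SES j q) {a : Ideal R}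
    {i : ℕ} (hB : Subsingleton (H a (i + 1) B)) (hC : ∀ η : H a i C, ∃ β, Hmap a i q β = η) :
    Subsingleton (H a (i + 1) A) := by
  refine subsingleton_of_forall_eq 0 fun ξ => ?_
  rw [← one_smul R ξ]
  exact S.kill 1 (fun η => by rw [one_smul]; exact hC η) ξ (Subsingleton.elim _ _)

lemma H_tors [IsNoetherianRing R] (a : Ideal R) (i : ℕ) : ∀ (N : Type) [AddCommGroup N]
    [Module R N], Tors a N → Subsingleton (H a (i + 1) (ModuleCat.of R N)) := by
  induction i with
  | zero =>
    intro N _ _ hN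
    let E : ModuleCat.{0} R := Injective.under (ModuleCat.of R N)
    let e : ModuleCat.of R N ⟶ E := Injective.ι _
    have he : Function.Injective e := (ModuleCat.mono_iff_injective _).1 inferInstance
    have hE : Injective (ModuleCat.of R E) := Injective.injective_under (ModuleCat.of R N)
    have : Module.Injective R E := Module.injective_module_of_injective_object R E
    have h1 : Module.Injective R (Gam a E) := (Gam_baer a E).injective
    have h2 : Injective (ModuleCat.of R (Gam a E)) := Module.injective_object_of_injective_module R _
    let f : N →ₗ[R] Gam a E := e.hom.codRestrict _ (fun x => by
      obtain ⟨n, hn⟩ := hN x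
      refine ⟨n, fun r hr => ?_⟩
      rw [← map_smul]
      exact (congrArg e.hom (hn r hr)).trans (map_zero _))
    have hf : Function.Injective f := fun x y h => he (congrArg Subtype.val h)
    refine (SES_coker f hf).left_zero (H_injective _) ?_
    refine H0_surj _ (SES_coker f hf).surj ?_
    intro x
    obtain ⟨n, hn⟩ := x.2
    exact ⟨n, fun r hr => Subtype.ext (hn r hr)⟩
  | succ i ih =>
    intro N _ _ hN
    let E : ModuleCat.{0} R := Injective.under (ModuleCat.of R N)
    let e : ModuleCat.of R N ⟶ E := Injective.ι _
    have he : Function.Injective e := (ModuleCat.mono_iff_injective _).1 inferInstance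
    have hE : Injective (ModuleCat.of R E) := Injective.injective_under (ModuleCat.of R N)
    have : Module.Injective R E := Module.injective_module_of_injective_object R E
    have h1 : Module.Injective R (Gam a E) := (Gam_baer a E).injective
    have h2 : Injective (ModuleCat.of R (Gam a E)) := Module.injective_object_of_injective_module R _
    let f : N →ₗ[R] Gam a E := e.hom.codRestrict _ (fun x => by
      obtain ⟨n, hn⟩ := hN x
      refine ⟨n, fun r hr => ?_⟩
      rw [← map_smul]
      exact (congrArg e.hom (hn r hr)).trans (map_zero _))
    have hf : Function.Injective f := fun x y h => he (congrArg Subtype.val h)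
    refine (SES_coker f hf).left_zero (H_injective _) ?_
    have := ih (Gam a E ⧸ LinearMap.range f) (by
      intro x
      obtain ⟨y, rfl⟩ := Submodule.Quotient.mk_surjective _ x
      obtain ⟨n, hn⟩ := y.2
      refine ⟨n, fun r hr => ?_⟩
      have : r • y = 0 := Subtype.ext (hn r hr)
      rw [← Submodule.Quotient.mk_smul, this, Submodule.Quotient.mk_zero])
    exact fun η => ⟨0, Subsingleton.elim _ _⟩

/-- `x`-power torsion -/
def XT (x : R) (M : Type) [AddCommGroup M] [Module R M] : Prop :=
  ∀ m : M, ∃ n : ℕ, x ^ n • m = 0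

lemma tors_of_XT {a : Ideal R} (s : Finset R) (hs : Ideal.span (s : Set R) = a)
    {M : Type} [AddCommGroup M] [Module R M] (h : ∀ x ∈ s, XT x M) : Tors a M := by
  intro m
  have h1 : a ≤ (Ideal.torsionOf R M m).radical := by
    rw [← hs, Ideal.span_le]
    intro x hx
    obtain ⟨n, hn⟩ := h x hx m
    exact ⟨n, hn⟩
  obtain ⟨n, hn⟩ := Ideal.exists_pow_le_of_le_radical_of_fg h1 ⟨s, hs⟩
  exact ⟨n, fun r hr => hn hr⟩

lemma Hmap_id_apply {a : Ideal R} {i : ℕ} {M : ModuleCat.{0} R} (ξ : H a i M) :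
    Hmap a i (𝟙 M) ξ = ξ := by
  exact congrArg (fun q => q.hom ξ) ((localCohomology a i).map_id M)

lemma Hmap_comp_apply {a : Ideal R} {i : ℕ} {M N L : ModuleCat.{0} R} (u : M ⟶ N) (v : N ⟶ L)
    (ξ : H a i M) : Hmap a i (u ≫ v) ξ = Hmap a i v (Hmap a i u ξ) := by
  exact congrArg (fun q => q.hom ξ) ((localCohomology a i).map_comp u v)

lemma H_loc {a : Ideal R} {x : R} (hx : x ∈ a) (i : ℕ) (M : Type) [AddCommGroup M] [Module R M]
    (hu : ∀ n : ℕ, IsUnit (algebraMap R (Module.End R M) (x ^ n))) :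
    Subsingleton (H a i (ModuleCat.of R M)) := by
  refine subsingleton_of_forall_eq 0 fun ξ => ?_
  obtain ⟨m, f, hf⟩ := rep_exists ξ
  have h0 := hf.torsion (x ^ m) (Ideal.pow_mem_pow hx m)
  obtain ⟨v, hv⟩ := hu m
  let w : ModuleCat.of R M ⟶ ModuleCat.of R M := ModuleCat.ofHom (v⁻¹ : (Module.End R M)ˣ).1
  have h1 : (x ^ m • 𝟙 (ModuleCat.of R M)) ≫ w = 𝟙 _ := by
    refine ModuleCat.hom_ext (LinearMap.ext fun y => ?_)
    have h2 : (v⁻¹ : (Module.End R M)ˣ).1 * v.1 = 1 := v.inv_mul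
    rw [hv] at h2
    exact LinearMap.congr_fun h2 y
  rw [← Hmap_id_apply ξ, ← h1, Hmap_comp_apply, Hmap_smul, h0, map_zero]

lemma H_bound [IsNoetherianRing R] {a : Ideal R} (s : Finset R) (hs : Ideal.span (s : Set R) = a)
    (t : Finset R) : t ⊆ s → ∀ (M : Type) [AddCommGroup M] [Module R M],
      (∀ x ∈ s, x ∉ t → XT x M) → ∀ i, t.card < i → Subsingleton (H a i (ModuleCat.of R M)) := by
  classical
  induction t using Finset.induction_on with
  | empty =>
    intro _ M _ _ h i hi
    obtain ⟨i, rfl⟩ := Nat.exists_eq_succ_of_ne_zero (n := i) (by rintro rfl; simp at hi)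
    exact H_tors a i M (tors_of_XT s hs fun x hx => h x hx (by simp))
  | insert x t hxt ih =>
    intro hts M _ _ h i hi
    rw [Finset.card_insert_of_notMem hxt] at hi
    obtain ⟨i, rfl⟩ := Nat.exists_eq_succ_of_ne_zero (n := i) (by omega)
    replace ih := ih ((Finset.subset_insert _ _).trans hts)
    have hxa : x ∈ a := hs ▸ Ideal.subset_span (hts (Finset.mem_insert_self _ _))
    let f : M →ₗ[R] LocalizedModule (Submonoid.powers x) M := LocalizedModule.mkLinearMap _ _
    have hloc : ∀ i, Subsingleton
        (H a i (ModuleCat.of R (LocalizedModule (Submonoid.powers x) M))) := fun i =>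
      H_loc hxa i _ (fun n => IsLocalizedModule.map_units f (⟨x ^ n, n, rfl⟩ : Submonoid.powers x))
    have hker : ∀ m, f m = 0 → ∃ n : ℕ, x ^ n • m = 0 := by
      intro m hm
      obtain ⟨⟨_, n, rfl⟩, hn⟩ := (IsLocalizedModule.eq_zero_iff (Submonoid.powers x) f).1 hm
      exact ⟨n, hn⟩
    have hsur : ∀ y, ∃ n : ℕ, ∃ m, x ^ n • y = f m := by
      intro y
      obtain ⟨⟨m, ⟨_, n, rfl⟩⟩, hn⟩ := IsLocalizedModule.surj (Submonoid.powers x) f y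
      exact ⟨n, m, hn⟩
    have hK := ih (LinearMap.ker f) (by
      intro y hy hyt m
      by_cases hxy : y = x
      · subst hxy
        obtain ⟨n, hn⟩ := hker m.1 m.2
        exact ⟨n, Subtype.ext hn⟩
      · obtain ⟨n, hn⟩ := h y hy (by simp [hxy, hyt]) m.1
        exact ⟨n, Subtype.ext hn⟩) (i + 1) (by omega)
    have hC := ih (LocalizedModule (Submonoid.powers x) M ⧸
        LinearMap.range (LinearMap.range f).subtype) (by
      intro y hy hyt m
      obtain ⟨m, rfl⟩ := Submodule.Quotient.mk_surjective _ m
      obtain ⟨n, m', hm'⟩ := hsur m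
      by_cases hxy : y = x
      · subst hxy
        refine ⟨n, ?_⟩
        rw [← Submodule.Quotient.mk_smul, Submodule.Quotient.mk_eq_zero, hm',
          Submodule.range_subtype]
        exact ⟨m', rfl⟩
      · obtain ⟨k, hk⟩ := h y hy (by simp [hxy, hyt]) m'
        refine ⟨k, ?_⟩
        have hu := IsLocalizedModule.map_units f (⟨x ^ n, n, rfl⟩ : Submonoid.powers x)
        have h0 : y ^ k • m = 0 := by
          rw [Module.End.isUnit_iff] at hu
          apply hu.1
          change x ^ n • (y ^ k • m) = x ^ n • (0 : LocalizedModule (Submonoid.powers x) M)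
          rw [smul_comm, hm', ← map_smul, hk, map_zero, smul_zero]
        rw [← Submodule.Quotient.mk_smul, h0, Submodule.Quotient.mk_zero]) i (by omega)
    have hI := (SES_coker (LinearMap.range f).subtype Subtype.val_injective).left_zero
      (a := a) (hloc (i + 1)) (fun η => ⟨0, Subsingleton.elim _ _⟩)
    refine subsingleton_of_forall_eq 0 fun ξ => ?_
    have hk2 : LinearMap.ker f.rangeRestrict = LinearMap.ker f := LinearMap.ker_rangeRestrict f
    rw [← hk2] at hK
    obtain ⟨ζ, rfl⟩ := (SES_ker f.rangeRestrict f.surjective_rangeRestrict).mid (a := a) ξ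
      (Subsingleton.elim _ _)
    rw [Subsingleton.elim ζ 0, map_zero]

lemma H_pi (a : Ideal R) (i n : ℕ) (ξ : H a i (ModuleCat.of R (Fin n → R))) :
    ξ = ∑ k, Hmap a i (ModuleCat.ofHom (LinearMap.single R (fun _ : Fin n => R) k))
      (Hmap a i (ModuleCat.ofHom (LinearMap.proj (φ := fun _ : Fin n => R) k)) ξ) := by
  have h1 : 𝟙 (ModuleCat.of R (Fin n → R)) =
      ∑ k, ModuleCat.ofHom (LinearMap.proj (φ := fun _ : Fin n => R) k) ≫
        ModuleCat.ofHom (LinearMap.single R (fun _ : Fin n => R) k) := by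
    refine ModuleCat.hom_ext ?_
    rw [ModuleCat.hom_sum]
    refine LinearMap.ext fun x => ?_
    rw [LinearMap.sum_apply]
    exact (Finset.univ_sum_single x).symm
  have h2 := congrArg (fun u => (Hmap a i u).hom ξ) h1
  simp only [Functor.map_sum, ModuleCat.hom_sum, LinearMap.sum_apply] at h2
  refine (Hmap_id_apply ξ).symm.trans (h2.trans ?_)
  exact Finset.sum_congr rfl fun k _ => Hmap_comp_apply _ _ ξ

lemma H_pi_zero {a : Ideal R} {i : ℕ} (h : Subsingleton (H a i (ModuleCat.of R R))) (n : ℕ) :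
    Subsingleton (H a i (ModuleCat.of R (Fin n → R))) := by
  refine subsingleton_of_forall_eq 0 fun ξ => ?_
  rw [H_pi a i n ξ]
  refine Finset.sum_eq_zero fun k _ => ?_
  have h0 : Hmap a i (ModuleCat.ofHom (LinearMap.proj (φ := fun _ : Fin n => R) k)) ξ = 0 :=
    h.elim _ _
  rw [h0, map_zero]

lemma H_fin [IsNoetherianRing R] {a : Ideal R}
    (h : ∀ i, 1 < i → Subsingleton (H a i (ModuleCat.of R R))) (i : ℕ) (hi : 1 < i)
    (M : Type) [AddCommGroup M] [Module R M] [Module.Finite R M] :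
    Subsingleton (H a i (ModuleCat.of R M)) := by
  obtain ⟨s, hs⟩ := (IsNoetherian.noetherian a : a.FG)
  have key : ∀ d i : ℕ, 1 < i → s.card < i + d → ∀ (M : Type) [AddCommGroup M] [Module R M]
      [Module.Finite R M], Subsingleton (H a i (ModuleCat.of R M)) := by
    intro d
    induction d with
    | zero =>
      intro i _ h2 M _ _ _
      exact H_bound s hs s subset_rfl M (fun x hx hx' => absurd hx hx') i h2
    | succ d ih =>
      intro i h1 h2 M _ _ _
      obtain ⟨n, f, hf⟩ := Module.Finite.exists_fin' R M
      have hK := ih (i + 1) (by omega) (by omega) (LinearMap.ker f)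
      have hF := H_pi_zero (h i h1) n
      refine subsingleton_of_forall_eq 0 fun ξ => ?_
      obtain ⟨ζ, rfl⟩ := (SES_ker f hf).surjH hK ξ
      rw [Subsingleton.elim ζ 0, map_zero]
  exact key (s.card + 1) i hi (by omega) M


lemma H_quot_surj [IsNoetherianRing R] {a : Ideal R}
    (h : ∀ i, 1 < i → Subsingleton (H a i (ModuleCat.of R R))) (J : Ideal R) (η : H a 1 (ModuleCat.of R (R ⧸ J))) :
    ∃ ξ, Hmap a 1 (ModuleCat.ofHom (Submodule.mkQ J)) ξ = η :=
  (SES_ideal J).surjH (H_fin h 2 (by omega) J) η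

lemma H_quot_ker [IsNoetherianRing R] {a : Ideal R}
    (h : ∀ i, 1 < i → Subsingleton (H a i (ModuleCat.of R R))) (J : Ideal R) (ξ : H a 1 (ModuleCat.of R R))
    (hξ : Hmap a 1 (ModuleCat.ofHom (Submodule.mkQ J)) ξ = 0) :
    ξ ∈ (J • ⊤ : Submodule R (H a 1 (ModuleCat.of R R))) := by
  obtain ⟨ζ, rfl⟩ := (SES_ideal J).mid ξ hξ
  obtain ⟨n, f, hf⟩ := Module.Finite.exists_fin' R J
  obtain ⟨ω, rfl⟩ := (SES_ker f hf).surjH (H_fin h 2 (by omega) (LinearMap.ker f)) ζ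
  rw [H_pi a 1 n ω, map_sum, map_sum]
  refine Submodule.sum_mem _ fun k _ => ?_
  rw [← Hmap_comp_apply, ← Hmap_comp_apply]
  generalize Hmap a 1 (ModuleCat.ofHom (LinearMap.proj (φ := fun _ : Fin n => R) k)) ω = ρ
  have e : (ModuleCat.ofHom (LinearMap.single R (fun _ : Fin n => R) k) ≫ ModuleCat.ofHom f) ≫
      ModuleCat.ofHom (Submodule.subtype J) =
      ((f (Pi.single k 1) : J) : R) • 𝟙 (ModuleCat.of R R) := by
    refine ModuleCat.hom_ext (LinearMap.ext_ring ?_)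
    exact (mul_one _).symm
  have e2 := congrArg (fun u => (Hmap a 1 u).hom ρ) e
  have e3 := e2.trans (Hmap_smul _ ρ)
  rw [Category.assoc] at e3
  refine Eq.mpr (congrArg (· ∈ _) e3) ?_
  exact Submodule.smul_mem_smul (f (Pi.single k 1)).2 trivial

lemma H_quot_smul {a : Ideal R} (J : Ideal R) (r : R) (hr : r ∈ J) (η : H a 1 (ModuleCat.of R (R ⧸ J))) :
    r • η = 0 := by
  rw [← Hmap_smul]
  have : r • 𝟙 (ModuleCat.of R (R ⧸ J)) = 0 := by
    refine ModuleCat.hom_ext (LinearMap.ext fun x => ?_)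
    obtain ⟨y, rfl⟩ := Submodule.Quotient.mk_surjective _ x
    exact (Submodule.Quotient.mk_eq_zero _).2 (J.mul_mem_right y hr)
  rw [this]
  have h0 : Hmap a 1 (0 : ModuleCat.of R (R ⧸ J) ⟶ ModuleCat.of R (R ⧸ J)) = 0 :=
    Functor.map_zero (localCohomology a 1) _ _
  exact congrArg (fun q => q.hom η) h0

lemma pow_smul_top [IsNoetherianRing R] {a : Ideal R}
    (h : ∀ i, 1 < i → Subsingleton (H a i (ModuleCat.of R R))) (n : ℕ) : (a ^ n • ⊤ : Submodule R (H a 1 (ModuleCat.of R R))) = ⊤ := by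
  rw [eq_top_iff]
  intro ξ _
  have : Subsingleton (H a (0 + 1) (ModuleCat.of R (R ⧸ a ^ n))) := by
    refine H_tors a 0 _ fun x => ⟨n, fun r hr => ?_⟩
    obtain ⟨y, rfl⟩ := Submodule.Quotient.mk_surjective _ x
    exact (Submodule.Quotient.mk_eq_zero _).2 ((a ^ n).mul_mem_right y hr)
  exact H_quot_ker h (a ^ n) ξ (this.elim _ _)

lemma att_sub [IsNoetherianRing R] {a : Ideal R}
    (h : ∀ i, 1 < i → Subsingleton (H a i (ModuleCat.of R R))) (p : Ideal R) (hp : p.IsPrime) (B : Submodule R (H a 1 (ModuleCat.of R R)))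
    (hB : p = Module.annihilator R (H a 1 (ModuleCat.of R R) ⧸ B)) :
    Nontrivial (H a 1 (ModuleCat.of R (R ⧸ p))) := by
  by_contra hn
  rw [not_nontrivial_iff_subsingleton] at hn
  have h1 : (p • ⊤ : Submodule R (H a 1 (ModuleCat.of R R))) ≤ B := by
    rw [Submodule.smul_le]
    intro r hr ξ _
    rw [hB, Module.mem_annihilator] at hr
    rw [← Submodule.Quotient.mk_eq_zero, Submodule.Quotient.mk_smul]
    exact hr _
  have h2 : B = ⊤ := by
    rw [eq_top_iff]
    intro ξ _
    exact h1 (H_quot_ker h p ξ (hn.elim _ _))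
  apply hp.ne_top
  rw [hB, h2, Ideal.eq_top_iff_one, Module.mem_annihilator]
  intro x
  exact Subsingleton.elim _ _

lemma att_sup [IsNoetherianRing R] {a : Ideal R}
    (h : ∀ i, 1 < i → Subsingleton (H a i (ModuleCat.of R R))) (p : Ideal R) (hp : p.IsPrime) (hn : Nontrivial (H a 1 (ModuleCat.of R (R ⧸ p)))) :
    p = Module.annihilator R
      (H a 1 (ModuleCat.of R R) ⧸ (p • ⊤ : Submodule R (H a 1 (ModuleCat.of R R)))) := by
  apply le_antisymm
  · intro r hr
    rw [Module.mem_annihilator]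
    intro x
    obtain ⟨y, rfl⟩ := Submodule.Quotient.mk_surjective _ x
    rw [← Submodule.Quotient.mk_smul, Submodule.Quotient.mk_eq_zero]
    exact Submodule.smul_mem_smul hr trivial
  · intro r hr
    by_contra hrp
    rw [Module.mem_annihilator] at hr
    let Q : H a 1 (ModuleCat.of R R) →ₗ[R] H a 1 (ModuleCat.of R (R ⧸ p)) :=
      (Hmap a 1 (ModuleCat.ofHom (Submodule.mkQ p))).hom
    have hQ : ∀ η, ∃ ξ, Q ξ = η := H_quot_surj h p
    have hkill : ∀ η : H a 1 (ModuleCat.of R (R ⧸ p)), r • η = 0 := by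
      intro η
      obtain ⟨ξ, rfl⟩ := hQ η
      have h1 := hr (Submodule.Quotient.mk ξ)
      rw [← Submodule.Quotient.mk_smul, Submodule.Quotient.mk_eq_zero] at h1
      have h2 : (p • ⊤ : Submodule R (H a 1 (ModuleCat.of R R))) ≤ LinearMap.ker Q := by
        rw [Submodule.smul_le]
        intro c hc ξ _
        rw [LinearMap.mem_ker, map_smul]
        exact H_quot_smul p c hc _
      rw [← map_smul]
      exact h2 h1
    let f : (R ⧸ p) →ₗ[R] (R ⧸ p) := r • LinearMap.id
    have hf : Function.Injective f := by
      rw [← LinearMap.ker_eq_bot, eq_bot_iff]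
      intro x hx
      obtain ⟨y, rfl⟩ := Submodule.Quotient.mk_surjective _ x
      have h1 : r * y ∈ p := (Submodule.Quotient.mk_eq_zero _).1 hx
      exact (Submodule.Quotient.mk_eq_zero _).2 ((hp.mem_or_mem h1).resolve_left hrp)
    obtain ⟨n, hnn⟩ := fg_unif a (Gam a ((R ⧸ p) ⧸ LinearMap.range f))
      (IsNoetherian.noetherian _) le_rfl
    have hz : ∀ s ∈ a ^ n, ∀ η : H a 1 (ModuleCat.of R (R ⧸ p)), s • η = 0 := by
      intro s hs η
      refine (SES_coker f hf).kill (i := 0) s (fun ρ => ⟨0, ?_⟩) η ?_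
      · rw [map_zero, H0_kill s (fun x m hm => hnn s hs x ⟨m, hm⟩) ρ]
      · exact (Hmap_smul r η).trans (hkill η)
    obtain ⟨η, hη⟩ := exists_ne (0 : H a 1 (ModuleCat.of R (R ⧸ p)))
    apply hη
    obtain ⟨ξ, rfl⟩ := hQ η
    have h2 : (a ^ n • ⊤ : Submodule R (H a 1 (ModuleCat.of R R))) ≤ LinearMap.ker Q := by
      rw [Submodule.smul_le]
      intro c hc ξ _
      rw [LinearMap.mem_ker, map_smul]
      exact hz c hc _
    rw [pow_smul_top h n] at h2
    exact h2 trivial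


end

end LC

theorem stmt17 {R : Type} [CommRing R] [IsNoetherianRing R]
    (a : Ideal R) (hcd : HasCD a (ModuleCat.of R R) 1) :
    attachedPrimes R ((localCohomology a 1).obj (ModuleCat.of R R)) =
      {p | p.IsPrime ∧ HasCD a (ModuleCat.of R (R ⧸ p)) 1} := by
  ext p
  constructor
  · rintro ⟨hp, B, hB⟩
    exact ⟨hp, LC.att_sub hcd.2 p hp B hB, fun i hi => LC.H_fin hcd.2 i hi (R ⧸ p)⟩
  · rintro ⟨hp, hn, -⟩
    exact ⟨hp, _, LC.att_sup hcd.2 p hp hn⟩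
end

section
/- Let R be a Noetherian ring, 𝔞 an ideal, and M a nonzero R-module (not necessarily finitely generated) such that c := cd(𝔞, M) = cd(𝔞, R/Ann_R M) is finite. Then Att_R(H^c_𝔞(M)) ⊆ { 𝔭 ∈ V(Ann_R M) : cd(𝔞, R/𝔭) = c }. -/
open CategoryTheory

section helperMaterial

open CategoryTheory Opposite Limits

section stageOne
variable {R : Type} [CommRing R]

/-- `ξ` in the homology is represented by `α`. -/
def RepK (K : ChainComplex (ModuleCat.{0} R)ᵒᵖ ℕ) (n : ℕ)
    (α : (K.X n).unop) (ξ : (K.homology n).unop) : Prop :=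
  ∃ β : (K.opcycles n).unop, (K.pOpcycles n).unop β = α ∧ (K.homologyι n).unop β = ξ

lemma RepK.exists_rep (K : ChainComplex (ModuleCat.{0} R)ᵒᵖ ℕ) (n : ℕ)
    (ξ : (K.homology n).unop) : ∃ α, RepK K n α ξ := by
  have : Function.Surjective (K.homologyι n).unop := by
    rw [← ModuleCat.epi_iff_surjective]; infer_instance
  obtain ⟨β, hβ⟩ := this ξ
  exact ⟨_, β, rfl, hβ⟩

lemma RepK.cocycle {K : ChainComplex (ModuleCat.{0} R)ᵒᵖ ℕ} {n : ℕ}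
    {α : (K.X n).unop} {ξ : (K.homology n).unop} (h : RepK K n α ξ) :
    (K.d (n+1) n).unop α = 0 := by
  obtain ⟨β, rfl, -⟩ := h
  have : (K.pOpcycles n).unop ≫ (K.d (n+1) n).unop = 0 := by
    rw [← unop_comp, K.d_pOpcycles]; rfl
  exact ConcreteCategory.congr_hom this β

lemma RepK.of_cocycle {K : ChainComplex (ModuleCat.{0} R)ᵒᵖ ℕ} {n : ℕ}
    (α : (K.X n).unop) (h : (K.d (n+1) n).unop α = 0) : ∃ ξ, RepK K n α ξ := by
  have ex := (ShortComplex.exact_of_g_is_cokernel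
    (ShortComplex.mk _ _ (K.d_pOpcycles (n+1) n)) (K.opcyclesIsCokernel (n+1) n (by simp))).unop
  obtain ⟨β, hβ⟩ := (ShortComplex.moduleCat_exact_iff _).1 ex α h
  exact ⟨_, β, hβ, rfl⟩

lemma RepK.coboundary {K : ChainComplex (ModuleCat.{0} R)ᵒᵖ ℕ} {n : ℕ}
    {α : (K.X n).unop} (h : RepK K n α 0) :
    ∃ j, ∃ η : (K.X j).unop, (K.d n j).unop η = α := by
  obtain ⟨β, rfl, h⟩ := h
  have ex := (ShortComplex.exact_of_f_is_kernel
    (ShortComplex.mk _ _ (K.homologyι_comp_fromOpcycles n _))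
      (K.homologyIsKernel n _ rfl)).unop
  obtain ⟨η, hη⟩ := (ShortComplex.moduleCat_exact_iff _).1 ex β h
  refine ⟨_, η, ?_⟩
  rw [← hη, ← K.p_fromOpcycles]
  rfl

lemma RepK.of_coboundary {K : ChainComplex (ModuleCat.{0} R)ᵒᵖ ℕ} {n j : ℕ}
    (η : (K.X j).unop) : RepK K n ((K.d n j).unop η) 0 := by
  refine ⟨(K.fromOpcycles n j).unop η, ?_, ?_⟩
  · rw [← K.p_fromOpcycles]; rfl
  · have : (K.fromOpcycles n j).unop ≫ (K.homologyι n).unop = 0 := by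
      rw [← unop_comp, K.homologyι_comp_fromOpcycles]; rfl
    exact ConcreteCategory.congr_hom this η

lemma RepK.map {K L : ChainComplex (ModuleCat.{0} R)ᵒᵖ ℕ} (g : K ⟶ L) {n : ℕ}
    {α : (L.X n).unop} {ξ : (L.homology n).unop} (h : RepK L n α ξ) :
    RepK K n ((g.f n).unop α) ((HomologicalComplex.homologyMap g n).unop ξ) := by
  obtain ⟨β, rfl, rfl⟩ := h
  refine ⟨(HomologicalComplex.opcyclesMap g n).unop β, ?_, ?_⟩
  · have : (HomologicalComplex.opcyclesMap g n).unop ≫ (K.pOpcycles n).unop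
      = (L.pOpcycles n).unop ≫ (g.f n).unop := by
      rw [← unop_comp, ← unop_comp, HomologicalComplex.p_opcyclesMap]
    exact ConcreteCategory.congr_hom this β
  · have : (HomologicalComplex.opcyclesMap g n).unop ≫ (K.homologyι n).unop
      = (L.homologyι n).unop ≫ (HomologicalComplex.homologyMap g n).unop := by
      rw [← unop_comp, ← unop_comp, HomologicalComplex.homologyι_naturality]
    exact ConcreteCategory.congr_hom this β

lemma RepK.add {K : ChainComplex (ModuleCat.{0} R)ᵒᵖ ℕ} {n : ℕ}
    {α α' : (K.X n).unop} {ξ ξ' : (K.homology n).unop} (h : RepK K n α ξ) (h' : RepK K n α' ξ') :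
    RepK K n (α + α') (ξ + ξ') := by
  obtain ⟨β, rfl, rfl⟩ := h
  obtain ⟨β', rfl, rfl⟩ := h'
  exact ⟨β + β', by simp, by simp⟩

lemma RepK.smul {K : ChainComplex (ModuleCat.{0} R)ᵒᵖ ℕ} {n : ℕ} (r : R)
    {α : (K.X n).unop} {ξ : (K.homology n).unop} (h : RepK K n α ξ) :
    RepK K n (r • α) (r • ξ) := by
  obtain ⟨β, rfl, rfl⟩ := h
  exact ⟨r • β, by simp, by simp⟩

lemma RepK.unique {K : ChainComplex (ModuleCat.{0} R)ᵒᵖ ℕ} {n : ℕ}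
    {α : (K.X n).unop} {ξ ξ' : (K.homology n).unop} (h : RepK K n α ξ) (h' : RepK K n α ξ') :
    ξ = ξ' := by
  obtain ⟨β, hβ, rfl⟩ := h
  obtain ⟨β', hβ', rfl⟩ := h'
  have : Function.Injective (K.pOpcycles n).unop := by
    rw [← ModuleCat.mono_iff_injective]; infer_instance
  rw [this (hβ.trans hβ'.symm)]

abbrev YF (Y : ModuleCat.{0} R) : ModuleCat.{0} R ⥤ (ModuleCat.{0} R)ᵒᵖ :=
  ((linearYoneda R (ModuleCat.{0} R)).obj Y).rightOp

def RepE {X : ModuleCat.{0} R} (P : ProjectiveResolution X) (Y : ModuleCat.{0} R) (n : ℕ)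
    (α : P.complex.X n ⟶ Y) (ξ : ((Ext R (ModuleCat.{0} R) n).obj (op X)).obj Y) : Prop :=
  ∃ ζ, RepK (((YF Y).mapHomologicalComplex _).obj P.complex) n α ζ ∧
    (P.isoLeftDerivedObj (YF Y) n).hom.unop ζ = ξ

variable {X : ModuleCat.{0} R} {P : ProjectiveResolution X} {Y : ModuleCat.{0} R} {n : ℕ}
  {α α' : P.complex.X n ⟶ Y} {ξ ξ' : ((Ext R (ModuleCat.{0} R) n).obj (op X)).obj Y}

lemma RepE.exists_rep (P : ProjectiveResolution X)
    (ξ : ((Ext R (ModuleCat.{0} R) n).obj (op X)).obj Y) : ∃ α, RepE P Y n α ξ := by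
  obtain ⟨α, hα⟩ := RepK.exists_rep (((YF Y).mapHomologicalComplex _).obj P.complex) n
    ((P.isoLeftDerivedObj (YF Y) n).inv.unop ξ)
  refine ⟨α, _, hα, ?_⟩
  have : (P.isoLeftDerivedObj (YF Y) n).inv.unop ≫ (P.isoLeftDerivedObj (YF Y) n).hom.unop = 𝟙 _ := by
    rw [← unop_comp, Iso.hom_inv_id]; rfl
  exact ConcreteCategory.congr_hom this ξ

lemma RepE.cocycle (h : RepE P Y n α ξ) : P.complex.d (n+1) n ≫ α = 0 := by
  obtain ⟨ζ, h, -⟩ := h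
  exact h.cocycle

lemma RepE.of_cocycle (h : P.complex.d (n+1) n ≫ α = 0) : ∃ ξ, RepE P Y n α ξ := by
  obtain ⟨ζ, h⟩ := RepK.of_cocycle
    (K := (((YF Y).mapHomologicalComplex _).obj P.complex)) (n := n) α h
  exact ⟨_, _, h, rfl⟩

lemma RepE.coboundary (h : RepE P Y n α 0) :
    ∃ j, ∃ η : P.complex.X j ⟶ Y, P.complex.d n j ≫ η = α := by
  obtain ⟨ζ, h, hz⟩ := h
  have : ζ = 0 := by
    have h2 : (P.isoLeftDerivedObj (YF Y) n).hom.unop ≫ (P.isoLeftDerivedObj (YF Y) n).inv.unop = 𝟙 _ := by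
      rw [← unop_comp, Iso.inv_hom_id]; rfl
    have h3 := ConcreteCategory.congr_hom h2 ζ
    change (P.isoLeftDerivedObj (YF Y) n).inv.unop ((P.isoLeftDerivedObj (YF Y) n).hom.unop ζ) = ζ at h3
    rw [hz] at h3
    rw [← h3]
    exact map_zero _
  subst this
  exact h.coboundary

lemma RepE.of_coboundary {j : ℕ} (η : P.complex.X j ⟶ Y) :
    RepE P Y n (P.complex.d n j ≫ η) 0 :=
  ⟨_, RepK.of_coboundary (K := (((YF Y).mapHomologicalComplex _).obj P.complex)) η, map_zero _⟩

lemma RepE.add (h : RepE P Y n α ξ) (h' : RepE P Y n α' ξ') : RepE P Y n (α + α') (ξ + ξ') := by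
  obtain ⟨ζ, h, rfl⟩ := h
  obtain ⟨ζ', h', rfl⟩ := h'
  exact ⟨_, h.add h', map_add _ _ _⟩

lemma RepE.smul (r : R) (h : RepE P Y n α ξ) : RepE P Y n (r • α) (r • ξ) := by
  obtain ⟨ζ, h, rfl⟩ := h
  exact ⟨_, h.smul r, map_smul _ _ _⟩

lemma RepE.unique (h : RepE P Y n α ξ) (h' : RepE P Y n α ξ') : ξ = ξ' := by
  obtain ⟨ζ, h, rfl⟩ := h
  obtain ⟨ζ', h', rfl⟩ := h'
  rw [h.unique h']

lemma RepE.mapY {Y' : ModuleCat.{0} R} (f : Y ⟶ Y') (h : RepE P Y n α ξ) :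
    RepE P Y' n (α ≫ f) (((Ext R (ModuleCat.{0} R) n).obj (op X)).map f ξ) := by
  obtain ⟨ζ, h, rfl⟩ := h
  refine ⟨_, RepK.map ((NatTrans.mapHomologicalComplex
    (NatTrans.rightOp ((linearYoneda R (ModuleCat.{0} R)).map f)) _).app P.complex) h, ?_⟩
  have e := P.leftDerived_app_eq (NatTrans.rightOp ((linearYoneda R (ModuleCat.{0} R)).map f)) n
  rw [← Category.assoc, Iso.eq_comp_inv] at e
  exact (ConcreteCategory.congr_hom (congrArg Quiver.Hom.unop e) ζ).symm

lemma RepE.mapX {X' : ModuleCat.{0} R} {P' : ProjectiveResolution X'} (f : X' ⟶ X)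
    (φ : P'.complex ⟶ P.complex) (comm : φ.f 0 ≫ P.π.f 0 = P'.π.f 0 ≫ f)
    (h : RepE P Y n α ξ) :
    RepE P' Y n (φ.f n ≫ α) (((Ext R (ModuleCat.{0} R) n).map f.op).app Y ξ) := by
  obtain ⟨ζ, h, rfl⟩ := h
  refine ⟨_, RepK.map (((YF Y).mapHomologicalComplex _).map φ) h, ?_⟩
  have e := ProjectiveResolution.isoLeftDerivedObj_hom_naturality f P' P φ comm (YF Y) n
  exact (ConcreteCategory.congr_hom (congrArg Quiver.Hom.unop e) ζ).symm

lemma RepE.smul_eq_zero {r : R} (hr : ∀ x : X, r • x = 0) (h : RepE P Y n α ξ) : r • ξ = 0 := by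
  have h1 := h.mapX (P' := P) (0 : X ⟶ X) (r • 𝟙 _) (by
    refine ModuleCat.hom_ext (LinearMap.ext fun x => ?_)
    have h3 : r • (P.π.f 0 x) = 0 := hr (P.π.f 0 x)
    have h4 : ((r • 𝟙 P.complex : P.complex ⟶ P.complex).f 0 ≫ P.π.f 0) x = r • (P.π.f 0 x) :=
      map_smul (P.π.f 0).hom r x
    exact h4.trans h3)
  have h2 := h.mapX (P' := P) (0 : X ⟶ X) 0
    ((zero_comp (f := P.π.f 0)).trans (comp_zero (f := P.π.f 0)).symm)
  have e1 : (r • 𝟙 P.complex : P.complex ⟶ P.complex).f n ≫ α = r • α := by simp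
  have e2 : (0 : P.complex ⟶ P.complex).f n ≫ α = (0 : R) • α := by simp
  rw [e1] at h1
  rw [e2] at h2
  rw [(h.smul r).unique h1, h2.unique (h.smul 0), zero_smul]

end stageOne

section fgres
variable {R : Type} [CommRing R]

open Classical in
/-- a projective cover object, finitely generated if possible -/
noncomputable def fgOverAux (Z : ModuleCat.{0} R) :
    { Q : (Q : ModuleCat.{0} R) × (Q ⟶ Z) // Projective Q.1 ∧ Epi Q.2 ∧
      (Module.Finite R Z → Module.Finite R Q.1) } := by
  apply Classical.choice
  by_cases h : Module.Finite R Z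
  · obtain ⟨n, f, hf⟩ := Module.Finite.exists_fin' R Z
    refine ⟨⟨⟨ModuleCat.of R (Fin n → R), ModuleCat.ofHom f⟩, ?_, ?_, fun _ => ?_⟩⟩
    · exact ModuleCat.projective_of_free (Pi.basisFun R (Fin n))
    · rw [ModuleCat.epi_iff_surjective]; exact hf
    · change Module.Finite R (Fin n → R); infer_instance
  · exact ⟨⟨⟨Projective.over Z, Projective.π Z⟩, inferInstance, inferInstance, fun h' => absurd h' h⟩⟩

noncomputable def fgOver (Z : ModuleCat.{0} R) : ModuleCat.{0} R := (fgOverAux Z).1.1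
noncomputable def fgπ (Z : ModuleCat.{0} R) : fgOver Z ⟶ Z := (fgOverAux Z).1.2
instance (Z : ModuleCat.{0} R) : Projective (fgOver Z) := (fgOverAux Z).2.1
instance (Z : ModuleCat.{0} R) : Epi (fgπ Z) := (fgOverAux Z).2.2.1
instance fgOver_finite (Z : ModuleCat.{0} R) [h : Module.Finite R Z] : Module.Finite R (fgOver Z) :=
  (fgOverAux Z).2.2.2 h


noncomputable abbrev fgSyz {X Y : ModuleCat.{0} R} (f : X ⟶ Y) : ModuleCat.{0} R :=
  fgOver (kernel f)
noncomputable def fgd {X Y : ModuleCat.{0} R} (f : X ⟶ Y) : fgSyz f ⟶ X := fgπ (kernel f) ≫ kernel.ι f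

lemma fgd_comp {X Y : ModuleCat.{0} R} (f : X ⟶ Y) : fgd f ≫ f = 0 := by
  rw [fgd, Category.assoc, kernel.condition, comp_zero]

lemma fgd_exact {X Y : ModuleCat.{0} R} (f : X ⟶ Y) :
    (ShortComplex.mk (fgd f) f (fgd_comp f)).Exact := by
  rw [ShortComplex.moduleCat_exact_iff]
  intro x hx
  have ex : (ShortComplex.mk (kernel.ι f) f (kernel.condition f)).Exact :=
    ShortComplex.exact_of_f_is_kernel _ (kernelIsKernel f)
  obtain ⟨y, hy⟩ := (ShortComplex.moduleCat_exact_iff _).1 ex x hx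
  obtain ⟨z, hz⟩ := (ModuleCat.epi_iff_surjective (fgπ (kernel f))).1 inferInstance y
  refine ⟨z, ?_⟩
  change kernel.ι f (fgπ (kernel f) z) = x
  rw [hz]; exact hy

lemma fgSyz_finite [IsNoetherianRing R] {X Y : ModuleCat.{0} R} (f : X ⟶ Y)
    [Module.Finite R X] : Module.Finite R (fgSyz f) := by
  have : Module.Finite R (kernel f : ModuleCat.{0} R) := by
    have : Function.Injective (kernel.ι f).hom :=
      (ModuleCat.mono_iff_injective _).1 inferInstance
    exact Module.Finite.of_injective _ this
  infer_instance

/-- an arrow of modules -/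
structure FgArr (R : Type) [CommRing R] where
  src : ModuleCat.{0} R
  tgt : ModuleCat.{0} R
  hom : src ⟶ tgt

noncomputable def fgStep (Z : ModuleCat.{0} R) : ℕ → FgArr R
  | 0 => ⟨fgOver Z, Z, fgπ Z⟩
  | n + 1 => ⟨fgSyz (fgStep Z n).hom, (fgStep Z n).src, fgd (fgStep Z n).hom⟩

noncomputable def fgX (Z : ModuleCat.{0} R) (n : ℕ) : ModuleCat.{0} R := (fgStep Z n).src
noncomputable def fgD (Z : ModuleCat.{0} R) (n : ℕ) : fgX Z (n + 1) ⟶ fgX Z n :=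
  (fgStep Z (n + 1)).hom

lemma fgD_comp (Z : ModuleCat.{0} R) (n : ℕ) : fgD Z (n + 1) ≫ fgD Z n = 0 :=
  fgd_comp _

lemma fgD_exact (Z : ModuleCat.{0} R) (n : ℕ) :
    (ShortComplex.mk (fgD Z (n + 1)) (fgD Z n) (fgD_comp Z n)).Exact :=
  fgd_exact _

instance (Z : ModuleCat.{0} R) (n : ℕ) : Projective (fgX Z n) := by
  cases n with
  | zero => exact (inferInstance : Projective (fgOver Z))
  | succ n => exact (inferInstance : Projective (fgOver (kernel (fgStep Z n).hom)))

lemma fgX_finite [IsNoetherianRing R] (Z : ModuleCat.{0} R) [Module.Finite R Z] (n : ℕ) :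
    Module.Finite R (fgX Z n) := by
  induction n with
  | zero => exact fgOver_finite Z
  | succ n ih => exact @fgSyz_finite R _ _ _ _ (fgStep Z n).hom ih

noncomputable def fgComplex (Z : ModuleCat.{0} R) : ChainComplex (ModuleCat.{0} R) ℕ :=
  ChainComplex.of (fgX Z) (fgD Z) (fgD_comp Z)

lemma fgComplex_d (Z : ModuleCat.{0} R) (n : ℕ) :
    (fgComplex Z).d (n + 1) n = fgD Z n := ChainComplex.of_d ..

lemma fgComplex_exactAt_succ (Z : ModuleCat.{0} R) (n : ℕ) :
    (fgComplex Z).ExactAt (n + 1) := by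
  rw [HomologicalComplex.exactAt_iff' _ (n + 1 + 1) (n + 1) n (by simp) (by simp)]
  have := fgD_exact Z n
  rw [ShortComplex.moduleCat_exact_iff] at this ⊢
  intro x hx
  change (fgComplex Z).d (n + 1) n x = 0 at hx
  rw [fgComplex_d] at hx
  obtain ⟨y, hy⟩ := this x hx
  refine ⟨y, ?_⟩
  change (fgComplex Z).d (n + 1 + 1) (n + 1) y = x
  rw [fgComplex_d]
  exact hy


noncomputable def fgε (Z : ModuleCat.{0} R) : (fgComplex Z).X 0 ⟶ Z := fgπ Z

instance (Z : ModuleCat.{0} R) : Epi (fgε Z) := (inferInstance : Epi (fgπ Z))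

lemma fgε_comp (Z : ModuleCat.{0} R) : (fgComplex Z).d 1 0 ≫ fgε Z = 0 := by
  rw [fgComplex_d]; exact fgd_comp _

lemma fgε_exact (Z : ModuleCat.{0} R) :
    (ShortComplex.mk _ _ (fgε_comp Z)).Exact := by
  have := fgd_exact (fgπ Z)
  rw [ShortComplex.moduleCat_exact_iff] at this ⊢
  intro x hx
  obtain ⟨y, hy⟩ := this x hx
  refine ⟨y, ?_⟩
  change (fgComplex Z).d 1 0 y = x
  rw [fgComplex_d]
  exact hy

noncomputable def fgRes (Z : ModuleCat.{0} R) : ProjectiveResolution Z where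
  complex := fgComplex Z
  projective n := (inferInstance : Projective (fgX Z n))
  π := (ChainComplex.toSingle₀Equiv _ _).symm ⟨fgε Z, fgε_comp Z⟩
  quasiIso := ⟨fun n => by
    cases n
    · rw [ChainComplex.quasiIsoAt₀_iff, ShortComplex.quasiIso_iff_of_zeros']
      · refine (ShortComplex.exact_and_epi_g_iff_of_iso ?_).2
          ⟨fgε_exact Z, (inferInstance : Epi (fgε Z))⟩
        exact ShortComplex.isoMk (Iso.refl _) (Iso.refl _) (Iso.refl _)
          (by simp; exact (Category.id_comp _).trans (Category.comp_id _).symm)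
          (by simp; exact (Category.id_comp _).trans (Category.comp_id _).symm)
      all_goals rfl
    · rw [quasiIsoAt_iff_exactAt']
      · apply fgComplex_exactAt_succ
      · apply ChainComplex.exactAt_succ_single_obj⟩

end fgres

section stageTwo
variable {R : Type} [CommRing R]

/-- chosen resolution of `R/a^t` -/
noncomputable def PR (a : Ideal R) (t : ℕ) : ProjectiveResolution (ModuleCat.of R (R ⧸ a ^ t)) :=
  fgRes _

noncomputable abbrev PC (a : Ideal R) (t : ℕ) : ChainComplex (ModuleCat.{0} R) ℕ := (PR a t).complex

lemma PC_finite [IsNoetherianRing R] (a : Ideal R) (t n : ℕ) : Module.Finite R ((PC a t).X n) := by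
  have : Module.Finite R (ModuleCat.of R (R ⧸ a ^ t)) := by
    change Module.Finite R (R ⧸ a ^ t); infer_instance
  exact fgX_finite _ n

instance (a : Ideal R) (t n : ℕ) : Projective ((PC a t).X n) := (PR a t).projective n

lemma PC_exact (a : Ideal R) (t n : ℕ) :
    (ShortComplex.mk ((PC a t).d (n+2) (n+1)) ((PC a t).d (n+1) n) (by simp)).Exact := 
  (PR a t).exact_succ n

/-- transition -/
noncomputable def trans0 (a : Ideal R) {t s : ℕ} (h : t ≤ s) :
    ModuleCat.of R (R ⧸ a ^ s) ⟶ ModuleCat.of R (R ⧸ a ^ t) :=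
  ModuleCat.ofHom <| Submodule.mapQ _ _ LinearMap.id (Ideal.pow_le_pow_right h)

noncomputable def tr (a : Ideal R) {t s : ℕ} (h : t ≤ s) : PC a s ⟶ PC a t :=
  ProjectiveResolution.lift (trans0 a h) (PR a s) (PR a t)

lemma tr_comm (a : Ideal R) {t s : ℕ} (h : t ≤ s) :
    (tr a h).f 0 ≫ (PR a t).π.f 0 = (PR a s).π.f 0 ≫ trans0 a h := by
  exact ProjectiveResolution.lift_commutes_zero _ _ _

/-- cone point maps -/
noncomputable def toH (a : Ideal R) (i t : ℕ) (M : ModuleCat.{0} R) :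
    ((Ext R (ModuleCat.{0} R) i).obj (op (ModuleCat.of R (R ⧸ a ^ t)))).obj M ⟶
      (localCohomology a i).obj M :=
  (colimit.ι (localCohomology.diagram (localCohomology.idealPowersDiagram a) i) (op (op t))).app M

lemma toH_trans (a : Ideal R) (i : ℕ) {t s : ℕ} (h : t ≤ s) (M : ModuleCat.{0} R) :
    ((Ext R (ModuleCat.{0} R) i).map (trans0 a h).op).app M ≫ toH a i s M = toH a i t M := by
  have := colimit.w (localCohomology.diagram (localCohomology.idealPowersDiagram a) i)
    (homOfLE h).op.op
  exact NatTrans.congr_app this M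

lemma toH_nat (a : Ideal R) (i t : ℕ) {M N : ModuleCat.{0} R} (f : M ⟶ N) :
    ((Ext R (ModuleCat.{0} R) i).obj (op (ModuleCat.of R (R ⧸ a ^ t)))).map f ≫ toH a i t N =
      toH a i t M ≫ (localCohomology a i).map f :=
  (colimit.ι (localCohomology.diagram (localCohomology.idealPowersDiagram a) i) (op (op t))).naturality f

noncomputable def isColim (a : Ideal R) (i : ℕ) (M : ModuleCat.{0} R) :=
  isColimitOfPreserves ((evaluation _ _).obj M) (colimit.isColimit
    (localCohomology.diagram (localCohomology.idealPowersDiagram a) i))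

lemma toH_surj (a : Ideal R) (i : ℕ) (M : ModuleCat.{0} R) (z : (localCohomology a i).obj M) :
    ∃ t ξ, toH a i t M ξ = z := by
  obtain ⟨j, y, hy⟩ := Concrete.isColimit_exists_rep _ (isColim a i M) z
  exact ⟨j.unop.unop, y, hy⟩

lemma toH_zero (a : Ideal R) (i t : ℕ) (M : ModuleCat.{0} R) (ξ) (h0 : toH a i t M ξ = 0) :
    ∃ s, ∃ h : t ≤ s, ((Ext R (ModuleCat.{0} R) i).map (trans0 a h).op).app M ξ = 0 := by
  obtain ⟨k, f, g, hk⟩ := Concrete.isColimit_exists_of_rep_eq _ (isColim a i M) 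
    (i := op (op t)) (j := op (op t)) ξ 0 (h0.trans (map_zero (toH a i t M).hom).symm)
  refine ⟨k.unop.unop, f.unop.unop.down.down, ?_⟩
  refine Eq.trans ?_ (hk.trans (map_zero (ModuleCat.Hom.hom _)))
  rfl

end stageTwo

section stageThree
variable {R : Type} [CommRing R]

def RepH (a : Ideal R) (i t : ℕ) {M : ModuleCat.{0} R} (α : (PC a t).X i ⟶ M)
    (z : (localCohomology a i).obj M) : Prop :=
  ∃ ξ, RepE (PR a t) M i α ξ ∧ toH a i t M ξ = z

variable {a : Ideal R} {i t : ℕ} {M : ModuleCat.{0} R} {α α' : (PC a t).X i ⟶ M}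
  {z z' : (localCohomology a i).obj M}

lemma RepH.exists_rep (z : (localCohomology a i).obj M) :
    ∃ t, ∃ α : (PC a t).X i ⟶ M, RepH a i t α z := by
  obtain ⟨t, ξ, h⟩ := toH_surj a i M z
  obtain ⟨α, hα⟩ := RepE.exists_rep (PR a t) ξ
  exact ⟨t, α, ξ, hα, h⟩

lemma RepH.cocycle (h : RepH a i t α z) : (PC a t).d (i+1) i ≫ α = 0 := by
  obtain ⟨ξ, h, -⟩ := h
  exact h.cocycle

lemma RepH.of_cocycle (h : (PC a t).d (i+1) i ≫ α = 0) : ∃ z, RepH a i t α z := by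
  obtain ⟨ξ, h⟩ := RepE.of_cocycle h
  exact ⟨_, ξ, h, rfl⟩

lemma RepH.mono (h : RepH a i t α z) {s : ℕ} (hs : t ≤ s) :
    RepH a i s ((tr a hs).f i ≫ α) z := by
  obtain ⟨ξ, h, rfl⟩ := h
  refine ⟨_, h.mapX _ _ (tr_comm a hs), ?_⟩
  exact ConcreteCategory.congr_hom (toH_trans a i hs M) ξ

lemma RepH.coboundary (h : RepH a i t α 0) :
    ∃ s, ∃ hs : t ≤ s, ∃ j, ∃ η : (PC a s).X j ⟶ M, (PC a s).d i j ≫ η = (tr a hs).f i ≫ α := by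
  obtain ⟨ξ, h, h0⟩ := h
  obtain ⟨s, hs, e⟩ := toH_zero a i t M ξ h0
  have := h.mapX _ _ (tr_comm a hs)
  rw [e] at this
  exact ⟨s, hs, this.coboundary⟩

lemma RepH.of_coboundary {j : ℕ} (η : (PC a t).X j ⟶ M) : RepH a i t ((PC a t).d i j ≫ η) 0 :=
  ⟨0, RepE.of_coboundary η, map_zero _⟩

lemma RepH.add (h : RepH a i t α z) (h' : RepH a i t α' z') : RepH a i t (α + α') (z + z') := by
  obtain ⟨ξ, h, rfl⟩ := h
  obtain ⟨ξ', h', rfl⟩ := h'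
  exact ⟨_, h.add h', map_add _ _ _⟩

lemma RepH.smul (r : R) (h : RepH a i t α z) : RepH a i t (r • α) (r • z) := by
  obtain ⟨ξ, h, rfl⟩ := h
  exact ⟨_, h.smul r, map_smul _ _ _⟩

lemma RepH.sub (h : RepH a i t α z) (h' : RepH a i t α' z') : RepH a i t (α - α') (z - z') := by
  have := h.add (h'.smul (-1))
  simpa [sub_eq_add_neg] using this

lemma RepH.zero' : RepH a i t (0 : _ ⟶ M) 0 := by
  have := RepH.of_coboundary (a := a) (i := i) (t := t) (j := 0) (0 : _ ⟶ M)
  simpa using this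

lemma RepH.unique (h : RepH a i t α z) (h' : RepH a i t α z') : z = z' := by
  obtain ⟨ξ, h, rfl⟩ := h
  obtain ⟨ξ', h', rfl⟩ := h'
  rw [h.unique h']

lemma RepH.map {N : ModuleCat.{0} R} (f : M ⟶ N) (h : RepH a i t α z) :
    RepH a i t (α ≫ f) ((localCohomology a i).map f z) := by
  obtain ⟨ξ, h, rfl⟩ := h
  exact ⟨_, h.mapY f, ConcreteCategory.congr_hom (toH_nat a i t f) ξ⟩

lemma RepH.smul_eq_zero {r : R} (hr : r ∈ a ^ t) (h : RepH a i t α z) : r • z = 0 := by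
  obtain ⟨ξ, h, rfl⟩ := h
  have : r • ξ = 0 := by
    refine h.smul_eq_zero ?_
    intro x
    obtain ⟨y, rfl⟩ := Ideal.Quotient.mk_surjective (I := a ^ t) x
    exact (Ideal.Quotient.eq_zero_iff_mem (I := a ^ t)).2 (Ideal.mul_mem_right y _ hr)
  rw [← map_smul, this, map_zero]

lemma lc_map_add {N : ModuleCat.{0} R} (f g : M ⟶ N) (z : (localCohomology a i).obj M) :
    (localCohomology a i).map (f + g) z =
      (localCohomology a i).map f z + (localCohomology a i).map g z := by
  obtain ⟨t, α, h⟩ := RepH.exists_rep z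
  have := (h.map f).add (h.map g)
  rw [← Preadditive.comp_add] at this
  exact (h.map _).unique this

lemma lc_map_smul {N : ModuleCat.{0} R} (r : R) (f : M ⟶ N) (z : (localCohomology a i).obj M) :
    (localCohomology a i).map (r • f) z = r • (localCohomology a i).map f z := by
  obtain ⟨t, α, h⟩ := RepH.exists_rep z
  have := (h.map f).smul r
  rw [← Linear.comp_smul] at this
  exact (h.map _).unique this

lemma lc_map_zero {N : ModuleCat.{0} R} (z : (localCohomology a i).obj M) :
    (localCohomology a i).map (0 : M ⟶ N) z = 0 := by
  have := lc_map_smul (0 : R) (0 : M ⟶ N) z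
  simpa using this

/-- exactness in the middle -/
lemma lc_exact (S : ShortComplex (ModuleCat.{0} R)) (hS : S.ShortExact)
    (z : (localCohomology a i).obj S.X₂) (hz : (localCohomology a i).map S.g z = 0) :
    ∃ w, (localCohomology a i).map S.f w = z := by
  have := hS.mono_f
  have := hS.epi_g
  obtain ⟨t, α, h⟩ := RepH.exists_rep z
  have h2 := h.map S.g
  rw [hz] at h2
  obtain ⟨s, hs, j, η, e⟩ := h2.coboundary
  have h3 := (h.mono hs).sub (RepH.of_coboundary (Projective.factorThru η S.g))
  have e3 : ((tr a hs).f i ≫ α - (PC a s).d i j ≫ Projective.factorThru η S.g) ≫ S.g = 0 := by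
    rw [Preadditive.sub_comp, Category.assoc, Category.assoc, Projective.factorThru_comp, e, sub_self]
  obtain ⟨w, hw⟩ := RepH.of_cocycle (a := a) (i := i) (t := s) (α := hS.exact.lift _ e3) (by
    rw [← cancel_mono S.f, Category.assoc, hS.exact.lift_f, h3.cocycle, zero_comp])
  refine ⟨w, ?_⟩
  have h4 := hw.map S.f
  rw [hS.exact.lift_f] at h4
  rw [h4.unique h3, sub_zero]

/-- surjectivity if the next one vanishes -/
lemma lc_surj (S : ShortComplex (ModuleCat.{0} R)) (hS : S.ShortExact)
    (h0 : Subsingleton ((localCohomology a (i+1)).obj S.X₁))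
    (z : (localCohomology a i).obj S.X₃) :
    ∃ w, (localCohomology a i).map S.g w = z := by
  have := hS.mono_f
  have := hS.epi_g
  obtain ⟨t, β, h⟩ := RepH.exists_rep z
  have e1 : ((PC a t).d (i+1) i ≫ Projective.factorThru β S.g) ≫ S.g = 0 := by
    rw [Category.assoc, Projective.factorThru_comp, h.cocycle]
  obtain ⟨y, hy⟩ := RepH.of_cocycle (a := a) (i := i+1) (t := t) (α := hS.exact.lift _ e1) (by
    rw [← cancel_mono S.f, Category.assoc, hS.exact.lift_f]; simp)
  rw [Subsingleton.elim y 0] at hy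
  obtain ⟨s, hs, j, η, e⟩ := hy.coboundary
  have key : ∃ θ : (PC a s).X i ⟶ S.X₁, (PC a s).d (i+1) i ≫ θ =
      (tr a hs).f (i+1) ≫ hS.exact.lift _ e1 := by
    by_cases hj : j = i
    · subst hj; exact ⟨η, e⟩
    · refine ⟨0, ?_⟩
      rw [← e, (PC a s).shape (i+1) j (by simp; omega)]; simp
  obtain ⟨θ, hθ⟩ := key
  obtain ⟨w, hw⟩ := RepH.of_cocycle (a := a) (i := i) (t := s)
    (α := (tr a hs).f i ≫ Projective.factorThru β S.g - θ ≫ S.f) (by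
      rw [Preadditive.comp_sub, ← Category.assoc _ θ, hθ, Category.assoc, hS.exact.lift_f,
        HomologicalComplex.Hom.comm_assoc, sub_self])
  refine ⟨w, ?_⟩
  have h4 := hw.map S.g
  rw [Preadditive.sub_comp, Category.assoc, Category.assoc, S.zero, comp_zero, sub_zero,
    Projective.factorThru_comp] at h4
  exact h4.unique (h.mono hs)

/-- vanishing of the connecting map -/
lemma lc_inj (S : ShortComplex (ModuleCat.{0} R)) (hS : S.ShortExact)
    (hs : ∀ z : (localCohomology a i).obj S.X₃, ∃ w, (localCohomology a i).map S.g w = z)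
    (z : (localCohomology a (i+1)).obj S.X₁) (hz : (localCohomology a (i+1)).map S.f z = 0) :
    z = 0 := by
  have := hS.mono_f
  have := hS.epi_g
  obtain ⟨t, γ, h⟩ := RepH.exists_rep z
  have h2 := h.map S.f
  rw [hz] at h2
  obtain ⟨s, hst, j, ε, e⟩ := h2.coboundary
  have key : ∃ θ : (PC a s).X i ⟶ S.X₂, (PC a s).d (i+1) i ≫ θ =
      (tr a hst).f (i+1) ≫ γ ≫ S.f := by
    by_cases hj : j = i
    · subst hj; exact ⟨ε, e⟩
    · refine ⟨0, ?_⟩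
      rw [← e, (PC a s).shape (i+1) j (by simp; omega)]; simp
  obtain ⟨θ, hθ⟩ := key
  obtain ⟨y, hy⟩ := RepH.of_cocycle (a := a) (i := i) (t := s) (α := θ ≫ S.g) (by
    rw [← Category.assoc, hθ]; simp)
  obtain ⟨w, rfl⟩ := hs y
  obtain ⟨u, ζ, hζ⟩ := RepH.exists_rep w
  have h5 := ((hy.mono (le_max_left s u)).sub ((hζ.map S.g).mono (le_max_right s u)))
  rw [sub_self] at h5
  obtain ⟨v, hv, k, κ, ek⟩ := h5.coboundary
  set lam := (tr a hv).f i ≫ (tr a (le_max_left s u)).f i ≫ θ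
    - (tr a hv).f i ≫ (tr a (le_max_right s u)).f i ≫ ζ
    - (PC a v).d i k ≫ Projective.factorThru κ S.g with hlam
  have e6 : lam ≫ S.g = 0 := by
    rw [hlam]
    simp only [Preadditive.sub_comp, Category.assoc, Projective.factorThru_comp, ek,
      Preadditive.comp_sub, sub_self]
  have h7 := (h.mono hst).mono (le_max_left s u) |>.mono hv
  have e8 : (PC a v).d (i+1) i ≫ hS.exact.lift lam e6 =
      (tr a hv).f (i+1) ≫ (tr a (le_max_left s u)).f (i+1) ≫ (tr a hst).f (i+1) ≫ γ := by
    rw [← cancel_mono S.f, Category.assoc, hS.exact.lift_f, hlam]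
    simp only [Preadditive.comp_sub, Category.assoc]
    rw [← HomologicalComplex.Hom.comm_assoc, ← HomologicalComplex.Hom.comm_assoc, hθ,
      ← HomologicalComplex.Hom.comm_assoc, ← HomologicalComplex.Hom.comm_assoc, hζ.cocycle]
    simp
  rw [← e8] at h7
  exact h7.unique (RepH.of_coboundary _)

lemma lc_injective (E : ModuleCat.{0} R) [Injective E] :
    Subsingleton ((localCohomology a (i+1)).obj E) := by
  refine subsingleton_of_forall_eq 0 fun z => ?_
  obtain ⟨t, γ, h⟩ := RepH.exists_rep z
  obtain ⟨η, hη⟩ : ∃ η, (PC a t).d (i+1) i ≫ η = γ :=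
    ⟨_, (PC_exact a t i).comp_descToInjective γ h.cocycle⟩
  rw [← hη] at h
  exact h.unique (RepH.of_coboundary _)

lemma lc_subsingleton_of_iso {M N : ModuleCat.{0} R} (e : M ≅ N)
    (h : Subsingleton ((localCohomology a i).obj M)) : Subsingleton ((localCohomology a i).obj N) := by
  have e' := ((localCohomology a i).mapIso e).toLinearEquiv
  exact e'.symm.toEquiv.subsingleton

lemma lc_finsupp [IsNoetherianRing R] (B : Type) [AddCommGroup B] [Module R B] (N : Type)
    (h0 : Subsingleton ((localCohomology a i).obj (ModuleCat.of R B))) :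
    Subsingleton ((localCohomology a i).obj (ModuleCat.of R (N →₀ B))) := by
  classical
  refine subsingleton_of_forall_eq 0 fun z => ?_
  obtain ⟨t, γ, h⟩ := RepH.exists_rep z
  obtain ⟨G, hG⟩ := (PC_finite a t i).fg_top
  let s : Finset N := G.biUnion fun g => (γ g : N →₀ B).support
  have hs : ∀ x, ((γ x : N →₀ B).support ⊆ s) := by
    intro x
    have hx : x ∈ Submodule.span R (G : Set ((PC a t).X i)) := by rw [hG]; trivial
    induction hx using Submodule.span_induction with
    | mem g hg => exact Finset.subset_biUnion_of_mem (fun g => (γ g : N →₀ B).support) hg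
    | zero => rw [map_zero]; exact Finset.empty_subset _
    | add x y _ _ hx hy =>
      rw [map_add]
      exact Finsupp.support_add.trans (Finset.union_subset hx hy)
    | smul r x _ hx =>
      rw [map_smul]
      exact Finsupp.support_smul.trans hx
  let p (n : N) : ModuleCat.of R (N →₀ B) ⟶ ModuleCat.of R B := ModuleCat.ofHom (Finsupp.lapply n)
  let q (n : N) : ModuleCat.of R B ⟶ ModuleCat.of R (N →₀ B) := ModuleCat.ofHom (Finsupp.lsingle n)
  have hterm : ∀ n, RepH a i t (γ ≫ p n ≫ q n) 0 := by
    intro n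
    have := (h.map (p n))
    rw [Subsingleton.elim ((localCohomology a i).map (p n) z) 0] at this
    have := this.map (q n)
    rwa [map_zero, Category.assoc] at this
  have hsum : ∀ u : Finset N, RepH a i t (∑ n ∈ u, γ ≫ p n ≫ q n) 0 := by
    intro u
    induction u using Finset.induction_on with
    | empty => simpa using RepH.zero'
    | insert n u hn ih =>
      rw [Finset.sum_insert hn]
      simpa using (hterm n).add ih
  have e : γ = ∑ n ∈ s, γ ≫ p n ≫ q n := by
    ext x
    have h1 : (γ x : N →₀ B) = ∑ n ∈ s, Finsupp.single n ((γ x : N →₀ B) n) := by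
      exact (Finsupp.sum_of_support_subset (γ x : N →₀ B) (hs x) (fun n b => Finsupp.single n b) (by simp)).symm.symm ▸ (Finsupp.sum_single (γ x : N →₀ B)).symm
    rw [ModuleCat.hom_sum, LinearMap.sum_apply]
    exact DFunLike.congr_fun h1 _
  rw [e] at h
  exact h.unique (hsum s)

end stageThree

section stageFour
variable {R : Type} [CommRing R] {a : Ideal R} {i t : ℕ}

noncomputable def augm (a : Ideal R) (t : ℕ) : (PC a t).X 0 ⟶ ModuleCat.of R (R ⧸ a ^ t) :=
  (PR a t).π.f 0

instance : Epi (augm a t) := by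
  have : Epi ((PR a t).π.f 0) := inferInstance
  exact this

lemma augm_d : (PC a t).d 1 0 ≫ augm a t = 0 := (PR a t).complex_d_comp_π_f_zero

lemma augm_exact : (ShortComplex.mk _ _ (augm_d (a := a) (t := t))).Exact := (PR a t).exact₀

lemma tr_augm {s : ℕ} (h : t ≤ s) : (tr a h).f 0 ≫ augm a t = augm a s ≫ trans0 a h :=
  tr_comm a h

/-- the map determined by a torsion element -/
noncomputable def hat {M : Type} [AddCommGroup M] [Module R M] (q : M)
    (h : ∀ r ∈ a ^ t, r • q = 0) : ModuleCat.of R (R ⧸ a ^ t) ⟶ ModuleCat.of R M :=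
  ModuleCat.ofHom ((a ^ t).liftQ (LinearMap.toSpanSingleton R M q) (fun r hr => h r hr))

lemma hat_one {M : Type} [AddCommGroup M] [Module R M] (q : M)
    (h : ∀ r ∈ a ^ t, r • q = 0) : hat q h (Ideal.Quotient.mk (a ^ t) 1) = q := by
  change (1 : R) • q = q
  simp

lemma quot_hom_ext {M : Type} [AddCommGroup M] [Module R M]
    {f g : ModuleCat.of R (R ⧸ a ^ t) ⟶ ModuleCat.of R M}
    (h : f (Ideal.Quotient.mk (a ^ t) 1) = g (Ideal.Quotient.mk (a ^ t) 1)) : f = g := by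
  refine ModuleCat.hom_ext (LinearMap.ext fun x => ?_)
  obtain ⟨y, rfl⟩ := Ideal.Quotient.mk_surjective (I := a ^ t) x
  have e : Ideal.Quotient.mk (a ^ t) y = y • Ideal.Quotient.mk (a ^ t) 1 := by
    rw [← Ideal.Quotient.mk_eq_mk, ← Ideal.Quotient.mk_eq_mk, ← Submodule.Quotient.mk_smul]
    simp
  rw [e]
  rw [map_smul, map_smul]
  exact congrArg (fun m => y • m) h

lemma rep_zero_factor {M : Type} [AddCommGroup M] [Module R M]
    (α : (PC a t).X 0 ⟶ ModuleCat.of R M) (hα : (PC a t).d 1 0 ≫ α = 0) :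
    ∃ (q : M) (h : ∀ r ∈ a ^ t, r • q = 0), α = augm a t ≫ hat q h := by
  let f : ModuleCat.of R (R ⧸ a ^ t) ⟶ ModuleCat.of R M := (augm_exact (a := a) (t := t)).desc α hα
  have hf : augm a t ≫ f = α := (augm_exact (a := a) (t := t)).g_desc α hα
  have h : ∀ r ∈ a ^ t, r • (f (Ideal.Quotient.mk (a ^ t) 1) : M) = 0 := by
    intro r hr
    have h1 : r • (f (Ideal.Quotient.mk (a ^ t) 1)) = f (r • Ideal.Quotient.mk (a ^ t) 1) :=
      (map_smul f.hom r _).symm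
    have h2 : r • Ideal.Quotient.mk (a ^ t) 1 = 0 := by
      rw [← Ideal.Quotient.mk_eq_mk, ← Submodule.Quotient.mk_smul]
      exact (Submodule.Quotient.mk_eq_zero _).2 (by simpa using hr)
    refine h1.trans ?_
    rw [h2]
    exact map_zero f.hom
  refine ⟨_, h, ?_⟩
  rw [← hf]
  congr 1
  exact quot_hom_ext (hat_one _ h).symm

variable {E Q : Type} [AddCommGroup E] [Module R E] [AddCommGroup Q] [Module R Q] (g : E →ₗ[R] Q)

lemma gamma_of_H0
    (hs : ∀ z : (localCohomology a 0).obj (ModuleCat.of R Q),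
      ∃ w, (localCohomology a 0).map (ModuleCat.ofHom g) w = z)
    (q : Q) (t : ℕ) (hq : ∀ r ∈ a ^ t, r • q = 0) :
    ∃ (e : E) (s : ℕ), (∀ r ∈ a ^ s, r • e = 0) ∧ g e = q := by
  obtain ⟨z, hz⟩ := RepH.of_cocycle (a := a) (i := 0) (t := t) (α := augm a t ≫ hat q hq) (by
    rw [← Category.assoc, augm_d, zero_comp])
  obtain ⟨w, rfl⟩ := hs z
  obtain ⟨u, β, hβ⟩ := RepH.exists_rep w
  have h5 := (hz.mono (le_max_left t u)).sub ((hβ.map (ModuleCat.ofHom g)).mono (le_max_right t u))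
  rw [sub_self] at h5
  obtain ⟨v, hv, k, κ, ek⟩ := h5.coboundary
  rw [(PC a v).shape 0 k (by simp), zero_comp, Preadditive.comp_sub] at ek
  have ek := sub_eq_zero.1 ek.symm
  obtain ⟨e, he, rfl⟩ := rep_zero_factor β hβ.cocycle
  refine ⟨e, u, he, ?_⟩
  simp only [Category.assoc] at ek
  rw [← Category.assoc (HomologicalComplex.Hom.f (tr a (le_max_left t u)) 0), tr_augm,
    ← Category.assoc (HomologicalComplex.Hom.f (tr a (le_max_right t u)) 0), tr_augm,
    Category.assoc, Category.assoc,
    ← Category.assoc (HomologicalComplex.Hom.f (tr a hv) 0), tr_augm,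
    ← Category.assoc (HomologicalComplex.Hom.f (tr a hv) 0), tr_augm,
    Category.assoc, Category.assoc, cancel_epi] at ek
  have := ConcreteCategory.congr_hom ek (Ideal.Quotient.mk (a ^ v) 1)
  exact ((congrArg g (hat_one e he)).symm.trans this.symm).trans (hat_one q hq)

lemma H0_of_gamma
    (hs : ∀ (q : Q) (t : ℕ), (∀ r ∈ a ^ t, r • q = 0) →
      ∃ (e : E) (s : ℕ), (∀ r ∈ a ^ s, r • e = 0) ∧ g e = q)
    (z : (localCohomology a 0).obj (ModuleCat.of R Q)) :
      ∃ w, (localCohomology a 0).map (ModuleCat.ofHom g) w = z := by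
  obtain ⟨t, α, h⟩ := RepH.exists_rep z
  obtain ⟨q, hq, rfl⟩ := rep_zero_factor α h.cocycle
  obtain ⟨e, s, he, hge⟩ := hs q t hq
  have he' : ∀ r ∈ a ^ (max t s), r • e = 0 :=
    fun r hr => he r (Ideal.pow_le_pow_right (le_max_right t s) hr)
  obtain ⟨w, hw⟩ := RepH.of_cocycle (a := a) (i := 0) (t := max t s) (α := augm a _ ≫ hat e he') (by
    rw [← Category.assoc, augm_d, zero_comp])
  refine ⟨w, ?_⟩
  have h1 := hw.map (ModuleCat.ofHom g)
  have h2 := h.mono (le_max_left t s)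
  rw [← Category.assoc, tr_augm, Category.assoc] at h2
  rw [Category.assoc] at h1
  have e3 : hat e he' ≫ ModuleCat.ofHom g = trans0 a (le_max_left t s) ≫ hat q hq := by
    apply quot_hom_ext
    exact ((congrArg g (hat_one e he')).trans hge).trans (hat_one q hq).symm
  rw [e3] at h1
  exact h1.unique h2

end stageFour

section stageFive
variable {R : Type} [CommRing R]

/-- vanishing of local cohomology -/
def LCZ (a : Ideal R) (i : ℕ) (N : Type) [AddCommGroup N] [Module R N] : Prop :=
  Subsingleton ((localCohomology a i).obj (ModuleCat.of R N))

variable {a : Ideal R} {i : ℕ}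
variable {A B C : Type} [AddCommGroup A] [Module R A] [AddCommGroup B] [Module R B]
  [AddCommGroup C] [Module R C]

/-- short complex from linear maps -/
def mkS (f : A →ₗ[R] B) (g : B →ₗ[R] C) (h : Function.Exact f g) : ShortComplex (ModuleCat.{0} R) :=
  ShortComplex.mk (ModuleCat.ofHom f) (ModuleCat.ofHom g) (by
    rw [← ModuleCat.ofHom_comp, h.linearMap_comp_eq_zero]; rfl)

lemma mkS_exact (f : A →ₗ[R] B) (g : B →ₗ[R] C) (h : Function.Exact f g)
    (hf : Function.Injective f) (hg : Function.Surjective g) : (mkS f g h).ShortExact :=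
  ModuleCat.shortComplex_shortExact _ h hf hg

lemma LCZ.mid (f : A →ₗ[R] B) (g : B →ₗ[R] C) (h : Function.Exact f g)
    (hf : Function.Injective f) (hg : Function.Surjective g)
    (hA : LCZ a i A) (hC : LCZ a i C) : LCZ a i B := by
  refine subsingleton_of_forall_eq 0 fun z => ?_
  obtain ⟨w, hw⟩ := lc_exact (mkS f g h) (mkS_exact f g h hf hg) z (hC.elim _ _)
  have : w = 0 := hA.elim _ _
  rw [← hw, this]
  exact map_zero ((localCohomology a i).map (mkS f g h).f).hom

lemma LCZ.right (f : A →ₗ[R] B) (g : B →ₗ[R] C) (h : Function.Exact f g)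
    (hf : Function.Injective f) (hg : Function.Surjective g)
    (hA : LCZ a (i+1) A) (hB : LCZ a i B) : LCZ a i C := by
  refine subsingleton_of_forall_eq 0 fun z => ?_
  obtain ⟨w, hw⟩ := lc_surj (mkS f g h) (mkS_exact f g h hf hg) hA z
  have : w = 0 := hB.elim _ _
  rw [← hw, this]
  exact map_zero ((localCohomology a i).map (mkS f g h).g).hom

lemma LCZ.left (f : A →ₗ[R] B) (g : B →ₗ[R] C) (h : Function.Exact f g)
    (hf : Function.Injective f) (hg : Function.Surjective g)
    (hB : LCZ a (i+1) B) (hC : LCZ a i C) : LCZ a (i+1) A := by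
  refine subsingleton_of_forall_eq 0 fun z => ?_
  refine lc_inj (mkS f g h) (mkS_exact f g h hf hg) (fun z => ⟨0, hC.elim _ _⟩) z (hB.elim _ _)

/-- the `x`-power torsion submodule -/
def xtors (x : R) (E : Type) [AddCommGroup E] [Module R E] : Submodule R E where
  carrier := {e | ∃ k : ℕ, x ^ k • e = 0}
  zero_mem' := ⟨0, by simp⟩
  add_mem' := by
    rintro u v ⟨k, hk⟩ ⟨l, hl⟩
    refine ⟨k + l, ?_⟩
    rw [smul_add, pow_add, mul_smul, mul_smul, hl, smul_zero, add_zero, smul_comm, hk, smul_zero]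
  smul_mem' := by
    rintro r u ⟨k, hk⟩
    exact ⟨k, by rw [smul_comm, hk, smul_zero]⟩

lemma xtors_baer [IsNoetherianRing R] (x : R) (E : Type) [AddCommGroup E] [Module R E]
    (hE : Module.Baer R E) : Module.Baer R (xtors x E) := by
  intro J f
  -- a uniform exponent
  obtain ⟨k, hk⟩ : ∃ k : ℕ, ∀ j : J, x ^ k • f j = 0 := by
    obtain ⟨G, hG⟩ := (inferInstance : Module.Finite R J).fg_top
    choose n hn using fun j : J => (f j).2
    refine ⟨G.sup n, fun j => ?_⟩
    have hj : j ∈ Submodule.span R (G : Set J) := by rw [hG]; trivial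
    induction hj using Submodule.span_induction with
    | mem y hy =>
      have : n y ≤ G.sup n := Finset.le_sup (f := n) hy
      apply Subtype.ext
      change x ^ (G.sup n) • (f y : E) = 0
      rw [← Nat.sub_add_cancel this, pow_add, mul_smul, hn, smul_zero]
    | zero => simp
    | add u v _ _ hu hv => rw [map_add, smul_add, hu, hv, add_zero]
    | smul r u _ hu => rw [map_smul, smul_comm, hu, smul_zero]
  -- stabilisation of colon ideals
  let K : ℕ →o Ideal R := ⟨fun n => Submodule.comap (LinearMap.mulLeft R (x ^ n)) J, by
    intro m n hmn s hs
    change x ^ n * s ∈ J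
    have hs : x ^ m * s ∈ J := hs
    rw [← Nat.sub_add_cancel hmn, pow_add, mul_assoc]
    exact J.mul_mem_left _ hs⟩
  obtain ⟨n0, hn0⟩ := monotone_stabilizes_iff_noetherian.2 (inferInstance : IsNoetherian R R) K
  let p : R →ₗ.[R] E := ⟨J, (xtors x E).subtype ∘ₗ f⟩
  let q : R →ₗ.[R] E := ⟨Ideal.span {x ^ (n0 + k)}, 0⟩
  have hpq : ∀ (u : p.domain) (v : q.domain), (u : R) = v → p u = q v := by
    intro u v huv
    change ((f u : xtors x E) : E) = 0
    obtain ⟨s, hs⟩ := Ideal.mem_span_singleton'.1 v.2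
    have h1 : s ∈ K (n0 + k) := by
      change x ^ (n0 + k) * s ∈ J
      rw [mul_comm, hs, ← huv]; exact u.2
    rw [← hn0 _ (Nat.le_add_right _ _)] at h1
    have h1 : x ^ n0 * s ∈ J := h1
    have h2 : u = x ^ k • (⟨x ^ n0 * s, h1⟩ : J) := by
      apply Subtype.ext
      change (u : R) = x ^ k * (x ^ n0 * s)
      rw [huv, ← hs]; ring
    rw [h2, map_smul, hk]; rfl
  obtain ⟨F, hF⟩ := hE _ (p.sup q hpq).toFun
  have hF1 : ∀ j (hj : j ∈ J), F j = f ⟨j, hj⟩ := by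
    intro j hj
    rw [hF j (Submodule.mem_sup_left hj)]
    exact ((LinearPMap.left_le_sup p q hpq).2 (x := ⟨j, hj⟩) rfl).symm
  have hx : x ^ (n0 + k) ∈ Ideal.span {x ^ (n0 + k)} := Ideal.mem_span_singleton_self _
  have hF2 : F (x ^ (n0 + k)) = 0 := by
    rw [hF _ (Submodule.mem_sup_right hx)]
    exact ((LinearPMap.right_le_sup p q hpq).2 (x := ⟨_, hx⟩) rfl).symm
  refine ⟨F.codRestrict (xtors x E) ?_, ?_⟩
  · intro r
    refine ⟨n0 + k, ?_⟩
    rw [← map_smul, smul_eq_mul, mul_comm, ← smul_eq_mul, map_smul, hF2, smul_zero]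
  · intro j hj
    exact Subtype.ext (hF1 j hj)

/-- embedding in an injective -/
lemma exists_baer (N : Type) [AddCommGroup N] [Module R N] :
    ∃ (E : Type) (_ : AddCommGroup E) (_ : Module R E) (f : N →ₗ[R] E),
      Function.Injective f ∧ Module.Baer R E := by
  let E := Injective.under (ModuleCat.of R N)
  have hinj : Injective (ModuleCat.of R E) :=
    inferInstanceAs (Injective (Injective.under (ModuleCat.of R N)))
  have := Module.injective_module_of_injective_object R E
  refine ⟨E, inferInstance, inferInstance, (Injective.ι (ModuleCat.of R N)).hom, ?_, ?_⟩
  · exact (ModuleCat.mono_iff_injective _).1 inferInstance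
  · exact Module.Baer.of_injective this

lemma LCZ.of_baer {E : Type} [AddCommGroup E] [Module R E] (hE : Module.Baer R E) :
    LCZ a (i+1) E := by
  have := hE.injective
  have := Module.injective_object_of_injective_module R E
  exact lc_injective _

end stageFive

section stageSix
variable {R : Type} [CommRing R]

lemma LCZ.add_tors [IsNoetherianRing R] {b : Ideal R} {x : R} (i : ℕ) :
    ∀ (N : Type) [AddCommGroup N] [Module R N], (∀ n : N, ∃ k : ℕ, x ^ k • n = 0) →
      LCZ b (i+1) N → LCZ (b ⊔ Ideal.span {x}) (i+1) N := by
  induction i with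
  | zero =>
    intro N _ _ hN hZ
    obtain ⟨E, _, _, f, hf, hE⟩ := exists_baer (R := R) N
    let f' : N →ₗ[R] xtors x E := f.codRestrict _ (fun n => by
      obtain ⟨k, hk⟩ := hN n
      exact ⟨k, by rw [← map_smul, hk, map_zero]⟩)
    have hf' : Function.Injective f' := fun u v h => hf (congrArg Subtype.val h)
    have hE' := xtors_baer x E hE
    let g := (LinearMap.range f').mkQ
    have hex : Function.Exact f' g := LinearMap.exact_map_mkQ_range f'
    have hg : Function.Surjective g := Submodule.mkQ_surjective _
    have h1 := lc_surj (a := b) (i := 0) (mkS f' g hex) (mkS_exact f' g hex hf' hg) hZ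
    have h2 := gamma_of_H0 g h1
    have h3 : ∀ (q : _) (t : ℕ), (∀ r ∈ (b ⊔ Ideal.span {x}) ^ t, r • q = 0) →
      ∃ (e : xtors x E) (s : ℕ), (∀ r ∈ (b ⊔ Ideal.span {x}) ^ s, r • e = 0) ∧ g e = q := by
      intro q t hq
      obtain ⟨e, s, he, hge⟩ := h2 q t (fun r hr => hq r (Ideal.pow_right_mono le_sup_left t hr))
      obtain ⟨k, hk⟩ := e.2
      refine ⟨e, s + k, ?_, hge⟩
      intro r hr
      have hr := Ideal.sup_pow_add_le_pow_sup_pow hr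
      obtain ⟨u, hu, v, hv, rfl⟩ := Submodule.mem_sup.1 hr
      rw [Ideal.span_singleton_pow] at hv
      obtain ⟨w, rfl⟩ := Ideal.mem_span_singleton'.1 hv
      have hk' : x ^ k • e = 0 := Subtype.ext hk
      rw [add_smul, he u hu, mul_smul, hk', smul_zero, add_zero]
    refine subsingleton_of_forall_eq 0 fun z => ?_
    exact lc_inj (mkS f' g hex) (mkS_exact f' g hex hf' hg) (H0_of_gamma g h3) z
      ((LCZ.of_baer hE').elim _ _)
  | succ i ih =>
    intro N _ _ hN hZ
    obtain ⟨E, _, _, f, hf, hE⟩ := exists_baer (R := R) N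
    let f' : N →ₗ[R] xtors x E := f.codRestrict _ (fun n => by
      obtain ⟨k, hk⟩ := hN n
      exact ⟨k, by rw [← map_smul, hk, map_zero]⟩)
    have hf' : Function.Injective f' := fun u v h => hf (congrArg Subtype.val h)
    have hE' := xtors_baer x E hE
    let g := (LinearMap.range f').mkQ
    have hex : Function.Exact f' g := LinearMap.exact_map_mkQ_range f'
    have hg : Function.Surjective g := Submodule.mkQ_surjective _
    have hQ := ih (xtors x E ⧸ LinearMap.range f') (fun q => by
      obtain ⟨e, rfl⟩ := hg q
      obtain ⟨k, hk⟩ := e.2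
      refine ⟨k, ?_⟩
      rw [← map_smul, show x ^ k • e = 0 from Subtype.ext hk, map_zero])
      (LCZ.right f' g hex hf' hg hZ (LCZ.of_baer hE'))
    exact LCZ.left f' g hex hf' hg (LCZ.of_baer hE') hQ

lemma LCZ.of_unit {a : Ideal R} {x : R} (hx : x ∈ a) {i : ℕ}
    {N : Type} [AddCommGroup N] [Module R N] (g : N →ₗ[R] N) (hg : ∀ n, x • g n = n) :
    LCZ a i N := by
  refine subsingleton_of_forall_eq 0 fun z => ?_
  obtain ⟨t, α, h⟩ := RepH.exists_rep z
  have h1 : x ^ t • z = 0 := h.smul_eq_zero (Ideal.pow_mem_pow hx t)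
  have key : ∀ w : (localCohomology a i).obj (ModuleCat.of R N), x • w = 0 → w = 0 := by
    intro w hw
    have e : x • ModuleCat.ofHom g = 𝟙 (ModuleCat.of R N) :=
      ModuleCat.hom_ext (LinearMap.ext hg)
    have h2 := lc_map_smul (a := a) (i := i) x (ModuleCat.ofHom g) w
    rw [e, CategoryTheory.Functor.map_id] at h2
    have h3 : x • (localCohomology a i).map (ModuleCat.ofHom g) w =
        (localCohomology a i).map (ModuleCat.ofHom g) (x • w) :=
      (map_smul ((localCohomology a i).map (ModuleCat.ofHom g)).hom x w).symm
    rw [h3, hw] at h2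
    exact h2.trans (map_zero ((localCohomology a i).map (ModuleCat.ofHom g)).hom)
  clear h α
  induction t with
  | zero => simpa using h1
  | succ t ih =>
    rw [pow_succ', mul_smul] at h1
    exact ih (key _ h1)

lemma LCZ.bot (i : ℕ) : ∀ (N : Type) [AddCommGroup N] [Module R N],
    LCZ (⊥ : Ideal R) (i+1) N := by
  induction i with
  | zero =>
    intro N _ _
    obtain ⟨E, _, _, f, hf, hE⟩ := exists_baer (R := R) N
    let g := (LinearMap.range f).mkQ
    have hex : Function.Exact f g := LinearMap.exact_map_mkQ_range f
    have hg : Function.Surjective g := Submodule.mkQ_surjective _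
    refine subsingleton_of_forall_eq 0 fun z => ?_
    refine lc_inj (mkS f g hex) (mkS_exact f g hex hf hg) (H0_of_gamma g ?_) z
      ((LCZ.of_baer hE).elim _ _)
    intro q t _
    obtain ⟨e, rfl⟩ := hg q
    refine ⟨e, 1, fun r hr => ?_, rfl⟩
    rw [pow_one] at hr
    rw [(Submodule.mem_bot R).1 hr, zero_smul]
  | succ i ih =>
    intro N _ _
    obtain ⟨E, _, _, f, hf, hE⟩ := exists_baer (R := R) N
    let g := (LinearMap.range f).mkQ
    have hex : Function.Exact f g := LinearMap.exact_map_mkQ_range f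
    have hg : Function.Surjective g := Submodule.mkQ_surjective _
    exact LCZ.left f g hex hf hg (LCZ.of_baer hE) (ih _)

lemma ker_exact {A B : Type} [AddCommGroup A] [Module R A] [AddCommGroup B] [Module R B]
    (f : A →ₗ[R] B) : Function.Exact (LinearMap.ker f).subtype f := by
  intro y
  simp

lemma LCZ.bounded_span [IsNoetherianRing R] (S : Finset R) :
    ∃ m, ∀ i, m ≤ i → ∀ (N : Type) [AddCommGroup N] [Module R N],
      LCZ (Ideal.span (S : Set R)) i N := by
  classical
  induction S using Finset.induction_on with
  | empty =>
    refine ⟨1, fun i hi N _ _ => ?_⟩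
    obtain ⟨j, rfl⟩ := Nat.exists_eq_add_of_le' hi
    simpa using LCZ.bot j N
  | insert x S _ ih =>
    obtain ⟨m, hm⟩ := ih
    have ha : Ideal.span ((insert x S : Finset R) : Set R)
        = Ideal.span (S : Set R) ⊔ Ideal.span {x} := by
      rw [Finset.coe_insert, Ideal.span_insert, sup_comm]
    rw [ha]
    have hx : x ∈ Ideal.span (S : Set R) ⊔ Ideal.span {x} :=
      Ideal.mem_sup_right (Ideal.mem_span_singleton_self x)
    have htors : ∀ i, m ≤ i → ∀ (N : Type) [AddCommGroup N] [Module R N],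
        (∀ n : N, ∃ k : ℕ, x ^ k • n = 0) →
        LCZ (Ideal.span (S : Set R) ⊔ Ideal.span {x}) (i+1) N :=
      fun i hi N _ _ hN => LCZ.add_tors i N hN (hm _ (by omega) N)
    refine ⟨m + 2, fun i hi N _ _ => ?_⟩
    obtain ⟨j, rfl⟩ := Nat.exists_eq_add_of_le' hi
    let f := LocalizedModule.mkLinearMap (Submonoid.powers x) N
    have hN' : ∀ i, LCZ (Ideal.span (S : Set R) ⊔ Ideal.span {x}) i
        (LocalizedModule (Submonoid.powers x) N) := by
      intro i
      obtain ⟨u, hu⟩ := IsLocalizedModule.map_units f (⟨x, Submonoid.mem_powers x⟩ :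
        Submonoid.powers x)
      refine LCZ.of_unit hx (↑u⁻¹ : Module.End R _) fun n => ?_
      have h1 := u.mul_inv
      rw [hu] at h1
      exact LinearMap.congr_fun h1 n
    have hC := htors (j + m) (by omega) (LocalizedModule (Submonoid.powers x) N ⧸ LinearMap.range f)
      (fun q => by
        obtain ⟨y, rfl⟩ := Submodule.mkQ_surjective _ q
        obtain ⟨⟨n, ⟨_, k, rfl⟩⟩, hn⟩ := IsLocalizedModule.surj (Submonoid.powers x) f y
        refine ⟨k, ?_⟩
        rw [← map_smul]
        exact (Submodule.Quotient.mk_eq_zero _).2 ⟨n, hn.symm⟩)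
    have hI : LCZ (Ideal.span (S : Set R) ⊔ Ideal.span {x}) (j + m + 1 + 1) (LinearMap.range f) :=
      LCZ.left (LinearMap.range f).subtype (LinearMap.range f).mkQ
        (LinearMap.exact_subtype_mkQ _) (Submodule.subtype_injective _)
        (Submodule.mkQ_surjective _) (hN' _) hC
    have hK := htors (j + m + 1) (by omega) (LinearMap.ker f) (fun q => by
        obtain ⟨⟨_, k, rfl⟩, hk⟩ := (IsLocalizedModule.eq_zero_iff (Submonoid.powers x) f).1 q.2
        exact ⟨k, Subtype.ext hk⟩)
    have hex : Function.Exact (LinearMap.ker f).subtype f.rangeRestrict := by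
      have := ker_exact f.rangeRestrict
      intro y
      simp [Subtype.ext_iff]
    exact LCZ.mid (LinearMap.ker f).subtype f.rangeRestrict hex (Submodule.subtype_injective _)
      (LinearMap.surjective_rangeRestrict f) hK hI

lemma LCZ.bounded [IsNoetherianRing R] (a : Ideal R) :
    ∃ m, ∀ i, m ≤ i → ∀ (N : Type) [AddCommGroup N] [Module R N], LCZ a i N := by
  obtain ⟨S, rfl⟩ := (isNoetherianRing_iff_ideal_fg R).1 inferInstance a
  exact LCZ.bounded_span S

lemma LCZ.key [IsNoetherianRing R] (a J : Ideal R) (n : ℕ) (h : ∀ i, n ≤ i → LCZ a i (R ⧸ J)) :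
    ∀ i, n ≤ i → ∀ (N : Type) [AddCommGroup N] [Module R N], (∀ r ∈ J, ∀ m : N, r • m = 0) →
      LCZ a i N := by
  obtain ⟨m, hm⟩ := LCZ.bounded a
  suffices H : ∀ d i, n ≤ i → m ≤ i + d → ∀ (N : Type) [AddCommGroup N] [Module R N],
      (∀ r ∈ J, ∀ m : N, r • m = 0) → LCZ a i N from
    fun i hi => H m i hi (by omega)
  intro d
  induction d with
  | zero => intro i _ hi N _ _ _; exact hm i hi N
  | succ d ih =>
    intro i hi hd N _ _ hN
    let φ : N → (R ⧸ J) →ₗ[R] N := fun m =>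
      J.liftQ (LinearMap.toSpanSingleton R N m) (fun r hr => hN r hr m)
    let g : (N →₀ (R ⧸ J)) →ₗ[R] N := Finsupp.lsum ℕ φ
    have hg : Function.Surjective g := by
      intro m
      refine ⟨Finsupp.single m (Ideal.Quotient.mk J 1), ?_⟩
      rw [Finsupp.lsum_single]
      change (1 : R) • m = m
      simp
    have hJ : ∀ r ∈ J, ∀ w : R ⧸ J, r • w = 0 := by
      intro r hr w
      obtain ⟨y, rfl⟩ := Ideal.Quotient.mk_surjective (I := J) w
      exact (Ideal.Quotient.eq_zero_iff_mem (I := J)).2 (Ideal.mul_mem_right y _ hr)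
    have hK : LCZ a (i+1) (LinearMap.ker g) := by
      refine ih (i+1) (by omega) (by omega) _ fun r hr w => ?_
      refine Subtype.ext (Finsupp.ext fun k => ?_)
      exact hJ r hr _
    exact LCZ.right _ g (ker_exact g) (Submodule.subtype_injective _) hg hK
      (lc_finsupp _ _ (h i hi))

end stageSix

section stageSeven
variable {R : Type} [CommRing R]

lemma lc_map_sum {a : Ideal R} {i : ℕ} {M N : ModuleCat.{0} R} {ι : Type} (T : Finset ι)
    (r : ι → R) (f : ι → (M ⟶ N)) (z : (localCohomology a i).obj M) :
    (localCohomology a i).map (∑ j ∈ T, r j • f j) z =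
      ∑ j ∈ T, r j • (localCohomology a i).map (f j) z := by
  classical
  induction T using Finset.induction_on with
  | empty => simpa using lc_map_zero z
  | insert j T hj ih => rw [Finset.sum_insert hj, Finset.sum_insert hj, lc_map_add, lc_map_smul, ih]

lemma ann_smul {a : Ideal R} {i : ℕ} {M : ModuleCat.{0} R} {r : R}
    (hr : r ∈ Module.annihilator R M) (z : (localCohomology a i).obj M) : r • z = 0 := by
  have e : r • 𝟙 M = 0 := ModuleCat.hom_ext (LinearMap.ext fun m => by
    exact Module.mem_annihilator.1 hr m)
  have h := lc_map_smul (a := a) (i := i) r (𝟙 M) z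
  rw [e, lc_map_zero, CategoryTheory.Functor.map_id] at h
  exact h.symm

lemma quot_killed {I J : Ideal R} (hIJ : I ≤ J) : ∀ r ∈ I, ∀ w : R ⧸ J, r • w = 0 := by
  intro r hr w
  obtain ⟨y, rfl⟩ := Ideal.Quotient.mk_surjective (I := J) w
  exact (Ideal.Quotient.eq_zero_iff_mem (I := J)).2 (Ideal.mul_mem_right y _ (hIJ hr))

lemma mem_smul_top [IsNoetherianRing R] {a : Ideal R} {c : ℕ} {M : ModuleCat.{0} R} {p : Ideal R}
    (h1 : ∀ i, c + 1 ≤ i → LCZ a i (R ⧸ Module.annihilator R M))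
    (h2 : ∀ i, c ≤ i → LCZ a i (R ⧸ p)) (z : (localCohomology a c).obj M) :
    z ∈ p • (⊤ : Submodule R ((localCohomology a c).obj M)) := by
  classical
  obtain ⟨S, hS⟩ := (isNoetherianRing_iff_ideal_fg R).1 inferInstance p
  let h : (S → M) →ₗ[R] M := ∑ s : S, (s : R) • LinearMap.proj s
  have hh : ∀ v, h v = ∑ s : S, (s : R) • v s := fun v => by simp [h]
  have hQ : LCZ a c (M ⧸ LinearMap.range h) := by
    refine LCZ.key a p c h2 c le_rfl _ ?_
    suffices p ≤ Module.annihilator R (M ⧸ LinearMap.range h) from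
      fun r hr m => Module.mem_annihilator.1 (this hr) m
    rw [← hS, Submodule.span_le]
    intro s hs
    refine Module.mem_annihilator.2 fun q => ?_
    obtain ⟨m, rfl⟩ := Submodule.mkQ_surjective _ q
    rw [← map_smul]
    refine (Submodule.Quotient.mk_eq_zero _).2 ⟨Pi.single ⟨s, hs⟩ m, ?_⟩
    rw [hh, Finset.sum_eq_single ⟨s, hs⟩]
    · rw [Pi.single_eq_same]
    · intro b _ hb
      rw [Pi.single_eq_of_ne hb, smul_zero]
    · intro hc
      exact absurd (Finset.mem_univ _) hc
  have hK : LCZ a (c+1) (LinearMap.ker h.rangeRestrict) := by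
    refine LCZ.key a _ (c+1) h1 (c+1) le_rfl _ fun r hr w => ?_
    refine Subtype.ext (funext fun s => ?_)
    exact Module.mem_annihilator.1 hr _
  have e1 := LinearMap.exact_subtype_mkQ (LinearMap.range h)
  obtain ⟨w, hw⟩ := lc_exact (a := a) (i := c) _ (mkS_exact _ _ e1 (Submodule.subtype_injective _)
    (Submodule.mkQ_surjective _)) z (hQ.elim _ _)
  obtain ⟨v, hv⟩ := lc_surj (a := a) (i := c) _ (mkS_exact _ _ (ker_exact h.rangeRestrict)
    (Submodule.subtype_injective _) (LinearMap.surjective_rangeRestrict h)) hK w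
  have e2 : (localCohomology a c).map (ModuleCat.ofHom h) v = z := by
    have e3 : ModuleCat.ofHom h = ModuleCat.ofHom h.rangeRestrict ≫
      ModuleCat.ofHom (LinearMap.range h).subtype := rfl
    rw [e3, Functor.map_comp]
    refine Eq.trans ?_ hw
    rw [← hv]
    rfl
  have e4 : (ModuleCat.ofHom h : ModuleCat.of R (S → M) ⟶ ModuleCat.of R M) =
      ∑ s : S, (s : R) • ModuleCat.ofHom (LinearMap.proj s) := by
    apply ModuleCat.hom_ext
    rw [ModuleCat.hom_sum]
    rfl
  rw [e4] at e2
  have e5 : z = ∑ s : S, (s : R) • (localCohomology a c).map 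
      (ModuleCat.ofHom (LinearMap.proj s) : ModuleCat.of R (S → M) ⟶ ModuleCat.of R M) v :=
    e2.symm.trans (lc_map_sum (M := ModuleCat.of R (S → M)) (N := ModuleCat.of R M)
      Finset.univ (fun s : S => (s : R)) (fun s => ModuleCat.ofHom (LinearMap.proj s)) v)
  rw [e5]
  refine Submodule.sum_mem _ fun s _ => Submodule.smul_mem_smul ?_ trivial
  rw [← hS]
  exact Submodule.subset_span s.2

end stageSeven

end helperMaterial

theorem stmt18 {R : Type} [CommRing R] [IsNoetherianRing R]
    (a : Ideal R) (M : ModuleCat R) (hM : Nontrivial M)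
    (c : ℕ) (hcd : HasCD a M c)
    (hcd' : HasCD a (ModuleCat.of R (R ⧸ Module.annihilator R M)) c) :
    attachedPrimes R ((localCohomology a c).obj M) ⊆
      {p | Module.annihilator R M ≤ p ∧ HasCD a (ModuleCat.of R (R ⧸ p)) c} := by
  rintro p ⟨hp, B, hB⟩
  have hle : Module.annihilator R M ≤ p := by
    intro r hr
    rw [hB]
    refine Module.mem_annihilator.2 fun q => ?_
    obtain ⟨z, rfl⟩ := Submodule.mkQ_surjective _ q
    rw [← map_smul, ann_smul hr, map_zero]
  have h1 : ∀ i, c + 1 ≤ i → LCZ a i (R ⧸ Module.annihilator R M) := fun i hi => hcd'.2 i hi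
  have hv : ∀ i, c < i → LCZ a i (R ⧸ p) := fun i hi =>
    LCZ.key a _ (c+1) h1 i hi _ (quot_killed hle)
  refine ⟨hle, ?_, hv⟩
  by_contra hn
  rw [not_nontrivial_iff_subsingleton] at hn
  have h2 : ∀ i, c ≤ i → LCZ a i (R ⧸ p) := by
    intro i hi
    rcases hi.eq_or_lt with rfl | hlt
    · exact hn
    · exact hv i hlt
  apply hp.ne_top
  rw [Ideal.eq_top_iff_one, hB]
  refine Module.mem_annihilator.2 fun q => ?_
  rw [one_smul]
  obtain ⟨z, rfl⟩ := Submodule.mkQ_surjective _ q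
  have hz := mem_smul_top h1 h2 z
  refine Submodule.smul_induction_on hz (fun r hr n _ => ?_) (fun u v hu hv => ?_)
  · rw [map_smul]
    rw [hB] at hr
    exact Module.mem_annihilator.1 hr _
  · rw [map_add, hu, hv, add_zero]
end
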